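/- For every real ε > 0 there exists N > 0 such that for every even integer n > N, the number of cubic simple graphs on the vertex set {1,…,n} with girth at least 16 and independence number greater than 0.454·n is less than ε times the total number of cubic simple graphs on the vertex set {1,…,n} with girth at least 16. (That is, almost no n-vertex cubic graphs of girth at least 16 have independence ratio larger than 0.454.) -/

import Mathlib

/-- A set of vertices is independent if its vertices are pairwise nonadjacent. -/
def IsIndep {V : Type*} (G : SimpleGraph V) (s : Set V) : Prop :=
  s.Pairwise fun u v => ¬ G.Adj u v

/-- The independence number of a graph: the largest size of an independent set. -/
noncomputable def indepNum {V : Type*} (G : SimpleGraph V) : ℕ :=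
  sSup {n | ∃ s : Set V, IsIndep G s ∧ s.ncard = n}

/-- A graph is cubic (3-regular) if every vertex has exactly three neighbors. -/
def IsCubic {V : Type*} (G : SimpleGraph V) : Prop :=
  ∀ v : V, (G.neighborSet v).ncard = 3

/-- `A` is an AI set (almost independent set) if the subgraph induced by `A` has maximum
degree at most 1, i.e. every vertex of `A` has at most one neighbor inside `A`. -/
def IsAI {V : Type*} (G : SimpleGraph V) (A : Set V) : Prop :=
  ∀ a ∈ A, ({b | b ∈ A ∧ G.Adj a b}).ncard ≤ 1

/-- `A` is a MAI set (maximum almost independent set) if `A` is an AI set containing an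
independent set of maximum size `α(G)`, and `A` is largest among such sets. -/
def IsMAI {V : Type*} (G : SimpleGraph V) (A : Set V) : Prop :=
  IsAI G A ∧ (∃ s ⊆ A, IsIndep G s ∧ s.ncard = indepNum G) ∧
    ∀ A' : Set V, IsAI G A' → (∃ s ⊆ A', IsIndep G s ∧ s.ncard = indepNum G) →
      A'.ncard ≤ A.ncard

/-- The polynomial iterates increasing to `1 - √(1 - x)` on `[0, 1)`. -/
noncomputable def sqrtIterate (x : ℝ) : ℕ → ℝ
  | 0 => 0
  | n + 1 => (x + sqrtIterate x n ^ 2) / 2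

lemma sqrtIterate_bounds {x : ℝ} (h0 : 0 ≤ x) (h1 : x < 1) (n : ℕ) :
    0 ≤ sqrtIterate x n ∧ sqrtIterate x n ≤ 1 - √(1 - x) ∧
      1 - √(1 - x) - sqrtIterate x n ≤ (1 - √(1 - x)) ^ (n + 1) := by
  have hs : √(1 - x) ^ 2 = 1 - x := Real.sq_sqrt (by linarith)
  have hs0 : 0 ≤ √(1 - x) := Real.sqrt_nonneg _
  have hs1 : √(1 - x) ≤ 1 := by nlinarith
  generalize √(1 - x) = s at *
  induction n with
  | zero => simp [sqrtIterate]; linarith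
  | succ n ih =>
    obtain ⟨a, b, c⟩ := ih
    simp only [sqrtIterate]
    refine ⟨by positivity, by nlinarith, ?_⟩
    calc 1 - s - (x + sqrtIterate x n ^ 2) / 2
        = (1 - s - sqrtIterate x n) * ((1 - s + sqrtIterate x n) / 2) := by
          rw [show x = 1 - s ^ 2 by linarith]; ring
      _ ≤ (1 - s) ^ (n + 1) * (1 - s) := by
          apply mul_le_mul c (by linarith) (by linarith) (pow_nonneg (by linarith) _)
      _ = _ := by ring

lemma tendsto_sqrtIterate {x : ℝ} (h0 : 0 ≤ x) (h1 : x < 1) :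
    Filter.Tendsto (sqrtIterate x) Filter.atTop (nhds (1 - √(1 - x))) := by
  have hs : 0 < √(1 - x) := Real.sqrt_pos.2 (by linarith)
  have hs1 : √(1 - x) ≤ 1 := Real.sqrt_le_one.2 (by linarith)
  have hp : Filter.Tendsto (fun n : ℕ => 1 - √(1 - x) - (1 - √(1 - x)) ^ (n + 1)) Filter.atTop
      (nhds (1 - √(1 - x))) := by
    have := ((tendsto_pow_atTop_nhds_zero_of_lt_one (r := 1 - √(1 - x)) (by linarith)
      (by linarith)).comp (Filter.tendsto_add_atTop_nat 1)).const_sub (1 - √(1 - x))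
    simpa using this
  refine tendsto_of_tendsto_of_tendsto_of_le_of_le hp tendsto_const_nhds ?_ ?_
  · intro n
    have := (sqrtIterate_bounds h0 h1 n).2.2
    simp only
    linarith
  · exact fun n => (sqrtIterate_bounds h0 h1 n).2.1

lemma sum_sqrt_kernel_nonneg {ι : Type*} [Fintype ι] [DecidableEq ι] {K : Matrix ι ι ℝ}
    (hK : K.PosSemidef) (h0 : ∀ i j, 0 ≤ K i j) (h1 : ∀ i j, K i j < 1) (c : ι → ℝ) :
    0 ≤ ∑ i, ∑ j, c i * c j * (1 - √(1 - K i j)) := by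
  have hpsd : ∀ n, (Matrix.of fun i j => sqrtIterate (K i j) n).PosSemidef := by
    intro n
    induction n with
    | zero => exact Matrix.PosSemidef.zero
    | succ n ih =>
      have := (hK.add (ih.hadamard ih)).smul (a := (1 / 2 : ℝ)) (by norm_num)
      convert this using 1
      ext i j
      simp [sqrtIterate]
      ring
  refine ge_of_tendsto (x := Filter.atTop)
    (f := fun n => ∑ i, ∑ j, c i * c j * sqrtIterate (K i j) n) ?_ ?_
  · exact tendsto_finsetSum _ fun i _ => tendsto_finsetSum _ fun j _ =>
      (tendsto_sqrtIterate (h0 i j) (h1 i j)).const_mul _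
  · refine Filter.Eventually.of_forall fun n => ?_
    have := (hpsd n).dotProduct_mulVec_nonneg c
    simp only [dotProduct, Matrix.mulVec, Pi.star_apply, star_trivial, Matrix.of_apply,
      Finset.mul_sum] at this
    refine this.trans_eq (Finset.sum_congr rfl fun i _ => Finset.sum_congr rfl fun j _ => ?_)
    ring

lemma posSemidef_gram {ι τ : Type*} [Fintype ι] (T : Finset τ) (ν : τ → ℝ)
    (hν : ∀ t ∈ T, 0 ≤ ν t) (h : ι → τ → ℝ) :
    (Matrix.of fun i j => ∑ t ∈ T, ν t * (h i t * h j t)).PosSemidef := by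
  refine Matrix.PosSemidef.of_dotProduct_mulVec_nonneg ?_ fun c => ?_
  · ext i j
    simp [Matrix.conjTranspose_apply, mul_comm]
  · have : star c ⬝ᵥ (Matrix.of fun i j => ∑ t ∈ T, ν t * (h i t * h j t)).mulVec c =
        ∑ t ∈ T, ν t * (∑ i, c i * h i t) ^ 2 := by
      simp only [dotProduct, Matrix.mulVec, Pi.star_apply, star_trivial, Matrix.of_apply,
        Finset.mul_sum, Finset.sum_mul, sq]
      rw [Finset.sum_congr rfl fun i _ => Finset.sum_comm, Finset.sum_comm]
      refine Finset.sum_congr rfl fun t _ => ?_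
      rw [Finset.sum_comm]
      refine Finset.sum_congr rfl fun i _ => Finset.sum_congr rfl fun j _ => ?_
      ring
    rw [this]
    exact Finset.sum_nonneg fun t ht => mul_nonneg (hν t ht) (sq_nonneg _)

/-- The convexity inequality behind the interpolation method: among weighted families, the
average gain of an edge is bounded by that of two independent fields of density `p`. -/
lemma sum_sqrt_edge_le {ι τ : Type*} [DecidableEq ι] (Λ : Finset ι) (T : Finset τ) (μ : τ → ℝ)
    (hμ : ∀ t ∈ T, 0 ≤ μ t) (g : ι → τ → ℝ) (hg0 : ∀ i t, 0 ≤ g i t) (hg1 : ∀ i t, g i t ≤ 1)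
    {a p : ℝ} (ha0 : 0 ≤ a) (ha1 : a < 1) (hp0 : 0 ≤ p) (hp1 : p ≤ 1) :
    ∑ i ∈ Λ, ∑ j ∈ Λ, √(∑ t ∈ T, μ t * (1 - a * (g i t * g j t))) ≤
      2 * Λ.card * ∑ i ∈ Λ, √(∑ t ∈ T, μ t * (1 - a * (p * g i t))) -
        (Λ.card : ℝ) ^ 2 * √((1 - a * p ^ 2) * ∑ t ∈ T, μ t) := by
  set Z := ∑ t ∈ T, μ t with hZ
  have hZ0 : 0 ≤ Z := Finset.sum_nonneg hμ
  rcases hZ0.eq_or_lt with hZz | hZp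
  · have hμ0 : ∀ t ∈ T, μ t = 0 := (Finset.sum_eq_zero_iff_of_nonneg hμ).1 (hZ ▸ hZz.symm)
    have key : ∀ f : τ → ℝ, ∑ t ∈ T, μ t * f t = 0 := fun f =>
      Finset.sum_eq_zero fun t ht => by rw [hμ0 t ht, zero_mul]
    simp [key, ← hZz]
  let f : Option Λ → τ → ℝ := fun i t => i.elim p fun j => g j t
  have hf0 : ∀ i t, 0 ≤ f i t := by rintro (_ | i) t; exacts [hp0, hg0 _ _]
  have hf1 : ∀ i t, f i t ≤ 1 := by rintro (_ | i) t; exacts [hp1, hg1 _ _]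
  have hν : ∀ t ∈ T, 0 ≤ μ t * a / Z := fun t ht =>
    div_nonneg (mul_nonneg (hμ t ht) ha0) hZ0
  let K : Matrix (Option Λ) (Option Λ) ℝ :=
    Matrix.of fun i j => ∑ t ∈ T, μ t * a / Z * (f i t * f j t)
  have hK0 : ∀ i j, 0 ≤ K i j := fun i j => Finset.sum_nonneg fun t ht =>
    mul_nonneg (hν t ht) (mul_nonneg (hf0 _ _) (hf0 _ _))
  have hK1 : ∀ i j, K i j < 1 := by
    intro i j
    calc K i j ≤ ∑ t ∈ T, μ t * a / Z := Finset.sum_le_sum fun t ht =>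
          mul_le_of_le_one_right (hν t ht) (mul_le_one₀ (hf1 _ _) (hf0 _ _) (hf1 _ _))
      _ = a := by rw [← Finset.sum_div, ← Finset.sum_mul, ← hZ]; field_simp
      _ < 1 := ha1
  have hsq : ∀ i j, √(1 - K i j) * √Z = √(∑ t ∈ T, μ t * (1 - a * (f i t * f j t))) := by
    intro i j
    rw [← Real.sqrt_mul (by linarith [hK1 i j])]
    congr 1
    simp only [K, Matrix.of_apply, sub_mul, one_mul, Finset.sum_mul, mul_sub, mul_one,
      Finset.sum_sub_distrib, ← hZ]
    congr 1
    refine Finset.sum_congr rfl fun t _ => ?_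
    field_simp
  have main := sum_sqrt_kernel_nonneg (K := K) (posSemidef_gram T _ hν f) hK0 hK1
    (fun i => i.elim (-(Λ.card : ℝ)) fun _ => 1)
  have main2 := mul_nonneg main (Real.sqrt_nonneg Z)
  simp only [Finset.sum_mul] at main2
  have hrw : ∀ i j : Option Λ, ∀ c : ℝ,
      c * (1 - √(1 - K i j)) * √Z
        = c * (√Z - √(∑ t ∈ T, μ t * (1 - a * (f i t * f j t)))) := by
    intro i j c
    rw [← hsq i j]
    ring
  simp only [hrw, Fintype.sum_option, Option.elim, f] at main2
  have hpp : ∑ t ∈ T, μ t * (1 - a * (p * p)) = (1 - a * p ^ 2) * Z := by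
    rw [← Finset.sum_mul, ← hZ]; ring
  have hcomm : ∀ i : Λ, ∑ t ∈ T, μ t * (1 - a * (g i t * p)) =
      ∑ t ∈ T, μ t * (1 - a * (p * g i t)) := fun i => by simp only [mul_comm p]
  simp only [hpp, hcomm] at main2
  simp only [← Finset.sum_coe_sort Λ]
  simp only [mul_sub, Finset.sum_sub_distrib, Finset.sum_add_distrib, Finset.sum_const,
    Finset.card_univ, Fintype.card_coe, one_mul, mul_one, nsmul_eq_mul, ← Finset.mul_sum] at main2
  simp only [mul_sub, mul_one, Finset.sum_sub_distrib]
  linarith [main2]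

section Interpolation

set_option linter.unusedSectionVars false

variable {V H : Type*} [Fintype V] [DecidableEq V] [DecidableEq H]

/-- The size of `I`, penalized by `1` for each constraint from `R` (edges) or `S` (fields) that
it violates, where `x` assigns vertices to half-edges. -/
def penalizedCard (x : H → V) (R : Finset (H × H)) (S : Finset H) (I : Finset V) : ℕ :=
  I.card - ((R.filter fun e => x e.1 ∈ I ∧ x e.2 ∈ I).card + (S.filter fun i => x i ∈ I).card)

/-- The largest penalized size of a vertex set. -/
def groundSize (x : H → V) (R : Finset (H × H)) (S : Finset H) : ℕ :=
  Finset.univ.sup (penalizedCard x R S)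

/-- A vertex is in the core of `f` if it lies in every maximizer of `f`. -/
def IsCore (f : Finset V → ℕ) (u : V) : Prop :=
  ∀ I, f I = Finset.univ.sup f → u ∈ I

open Classical in
lemma sup_sub_ite (f : Finset V → ℕ) (h0 : f ∅ = 0) (u v : V) :
    (Finset.univ.sup fun I => f I - if u ∈ I ∧ v ∈ I then 1 else 0) +
      (if IsCore f u ∧ IsCore f v then 1 else 0) = Finset.univ.sup f := by
  obtain ⟨I₀, -, hI₀⟩ := Finset.exists_mem_eq_sup (Finset.univ : Finset (Finset V))
    Finset.univ_nonempty f
  by_cases hc : IsCore f u ∧ IsCore f v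
  · rw [if_pos hc]
    have hpos : 0 < Finset.univ.sup f := by
      by_contra hn
      exact Finset.notMem_empty u (hc.1 ∅ (by omega))
    have h1 : Finset.univ.sup f - 1 ≤
        Finset.univ.sup fun I => f I - if u ∈ I ∧ v ∈ I then 1 else 0 := by
      refine le_trans ?_ (Finset.le_sup (Finset.mem_univ I₀))
      simp only [hc.1 I₀ hI₀.symm, hc.2 I₀ hI₀.symm, and_self, if_true]
      omega
    have h2 : (Finset.univ.sup fun I => f I - if u ∈ I ∧ v ∈ I then 1 else 0) ≤
        Finset.univ.sup f - 1 := by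
      refine Finset.sup_le fun I _ => ?_
      have hI := Finset.le_sup (f := f) (Finset.mem_univ I)
      by_cases hm : f I = Finset.univ.sup f
      · rw [if_pos ⟨hc.1 I hm, hc.2 I hm⟩, hm]
      · omega
    omega
  · rw [if_neg hc, add_zero]
    refine le_antisymm (Finset.sup_mono_fun fun I _ => Nat.sub_le _ _) ?_
    obtain ⟨I, hI, hIn⟩ : ∃ I, f I = Finset.univ.sup f ∧ ¬ (u ∈ I ∧ v ∈ I) := by
      by_contra! hn
      exact hc ⟨fun I hI => (hn I hI).1, fun I hI => (hn I hI).2⟩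
    rw [← hI]
    refine le_trans ?_ (Finset.le_sup (Finset.mem_univ I))
    simp [hIn]

lemma penalizedCard_empty (x : H → V) (R : Finset (H × H)) (S : Finset H) :
    penalizedCard x R S ∅ = 0 := by simp [penalizedCard]

lemma penalizedCard_insert_edge (x : H → V) {R : Finset (H × H)} {e : H × H} (he : e ∉ R)
    (S : Finset H) :
    penalizedCard x (insert e R) S =
      fun I => penalizedCard x R S I - if x e.1 ∈ I ∧ x e.2 ∈ I then 1 else 0 := by
  funext I
  unfold penalizedCard
  rw [Finset.filter_insert]
  split_ifs
  · rw [Finset.card_insert_of_notMem (by simp [he])]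
    omega
  · rfl

lemma penalizedCard_insert_field (x : H → V) (R : Finset (H × H)) {S : Finset H} {l : H}
    (hl : l ∉ S) :
    penalizedCard x R (insert l S) =
      fun I => penalizedCard x R S I - if x l ∈ I ∧ x l ∈ I then 1 else 0 := by
  funext I
  unfold penalizedCard
  rw [Finset.filter_insert]
  simp only [and_self]
  split_ifs
  · rw [Finset.card_insert_of_notMem (by simp [hl])]
    omega
  · rfl

lemma penalizedCard_congr {x y : H → V} {R : Finset (H × H)} {S : Finset H}
    (hR : ∀ e ∈ R, x e.1 = y e.1 ∧ x e.2 = y e.2) (hS : ∀ i ∈ S, x i = y i) :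
    penalizedCard x R S = penalizedCard y R S := by
  funext I
  unfold penalizedCard
  have h1 : (R.filter fun e => x e.1 ∈ I ∧ x e.2 ∈ I) = R.filter fun e => y e.1 ∈ I ∧ y e.2 ∈ I :=
    Finset.filter_congr fun e he => by rw [(hR e he).1, (hR e he).2]
  have h2 : (S.filter fun i => x i ∈ I) = S.filter fun i => y i ∈ I :=
    Finset.filter_congr fun i hi => by rw [hS i hi]
  rw [h1, h2]

/-- The partition function over random activations (with probability `p`) of the fields in `A`,
at weight `X ^ groundSize`. -/
noncomputable def gibbsSum (p X : ℝ) (x : H → V) (R : Finset (H × H)) (A : Finset H) : ℝ :=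
  ∑ S ∈ A.powerset, p ^ S.card * (1 - p) ^ (A.card - S.card) * X ^ groundSize x R S

lemma gibbsSum_nonneg {p X : ℝ} (hp0 : 0 ≤ p) (hp1 : p ≤ 1) (hX : 0 ≤ X) (x : H → V)
    (R : Finset (H × H)) (A : Finset H) : 0 ≤ gibbsSum p X x R A :=
  Finset.sum_nonneg fun S _ => mul_nonneg (mul_nonneg (pow_nonneg hp0 _)
    (pow_nonneg (by linarith) _)) (pow_nonneg hX _)

open Classical in
/-- The indicator that the half-edge `i` is attached to a core vertex. -/
noncomputable def coreIndicator (x : H → V) (R : Finset (H × H)) (i : H) (S : Finset H) : ℝ :=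
  if IsCore (penalizedCard x R S) (x i) then 1 else 0

lemma coreIndicator_nonneg (x : H → V) (R : Finset (H × H)) (i : H) (S : Finset H) :
    0 ≤ coreIndicator x R i S := by
  unfold coreIndicator; split_ifs <;> norm_num

lemma coreIndicator_le_one (x : H → V) (R : Finset (H × H)) (i : H) (S : Finset H) :
    coreIndicator x R i S ≤ 1 := by
  unfold coreIndicator; split_ifs <;> norm_num

lemma pow_groundSize_insert_edge {X : ℝ} (hX : X ≠ 0) (x : H → V) {R : Finset (H × H)}
    {e : H × H} (he : e ∉ R) (S : Finset H) :
    X ^ groundSize x (insert e R) S = X ^ groundSize x R S *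
      (1 - (1 - 1 / X) * (coreIndicator x R e.1 S * coreIndicator x R e.2 S)) := by
  classical
  have h := sup_sub_ite (penalizedCard x R S) (penalizedCard_empty _ _ _) (x e.1) (x e.2)
  unfold groundSize coreIndicator
  rw [penalizedCard_insert_edge x he, ← h]
  by_cases h1 : IsCore (penalizedCard x R S) (x e.1) <;>
  by_cases h2 : IsCore (penalizedCard x R S) (x e.2) <;> simp [h1, h2, pow_succ, hX]

lemma pow_groundSize_insert_field {X : ℝ} (hX : X ≠ 0) (x : H → V) (R : Finset (H × H))
    {S : Finset H} {l : H} (hl : l ∉ S) :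
    X ^ groundSize x R (insert l S) = X ^ groundSize x R S *
      (1 - (1 - 1 / X) * coreIndicator x R l S) := by
  classical
  have h := sup_sub_ite (penalizedCard x R S) (penalizedCard_empty _ _ _) (x l) (x l)
  unfold groundSize coreIndicator
  rw [penalizedCard_insert_field x R hl, ← h]
  by_cases h1 : IsCore (penalizedCard x R S) (x l) <;> simp [h1, pow_succ, hX]

lemma gibbsSum_insert_edge (p : ℝ) {X : ℝ} (hX : X ≠ 0) (x : H → V) {R : Finset (H × H)}
    {e : H × H} (he : e ∉ R) (A : Finset H) :
    gibbsSum p X x (insert e R) A = ∑ S ∈ A.powerset,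
      p ^ S.card * (1 - p) ^ (A.card - S.card) * X ^ groundSize x R S *
        (1 - (1 - 1 / X) * (coreIndicator x R e.1 S * coreIndicator x R e.2 S)) := by
  unfold gibbsSum
  refine Finset.sum_congr rfl fun S _ => ?_
  rw [pow_groundSize_insert_edge hX x he, ← mul_assoc]

lemma gibbsSum_insert_field (p : ℝ) {X : ℝ} (hX : X ≠ 0) (x : H → V) (R : Finset (H × H))
    {A : Finset H} {l : H} (hl : l ∉ A) :
    gibbsSum p X x R (insert l A) = ∑ S ∈ A.powerset,
      p ^ S.card * (1 - p) ^ (A.card - S.card) * X ^ groundSize x R S *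
        (1 - (1 - 1 / X) * (p * coreIndicator x R l S)) := by
  unfold gibbsSum
  rw [Finset.sum_powerset_insert hl, ← Finset.sum_add_distrib]
  refine Finset.sum_congr rfl fun S hS => ?_
  have hS' := Finset.mem_powerset.1 hS
  have hlS : l ∉ S := fun h => hl (hS' h)
  rw [pow_groundSize_insert_field hX x R hlS, Finset.card_insert_of_notMem hl,
    Finset.card_insert_of_notMem hlS, Nat.add_sub_add_right,
    Nat.succ_sub (Finset.card_le_card hS'), pow_succ, pow_succ]
  ring

lemma gibbsSum_le_insert_field {p X : ℝ} (hp0 : 0 ≤ p) (hp1 : p ≤ 1) (hX : 1 ≤ X) (x : H → V)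
    (R : Finset (H × H)) {A : Finset H} {l : H} (hl : l ∉ A) :
    (1 - p) * gibbsSum p X x R A ≤ gibbsSum p X x R (insert l A) := by
  rw [gibbsSum_insert_field p (by linarith) x R hl, gibbsSum, Finset.mul_sum]
  refine Finset.sum_le_sum fun S _ => ?_
  rw [mul_comm]
  have h1 := coreIndicator_le_one x R l S
  have h0 := coreIndicator_nonneg x R l S
  have ha : 1 - 1 / X ≤ 1 := by simp; linarith
  have ha' : 0 ≤ 1 - 1 / X := by rw [sub_nonneg, div_le_one (by linarith)]; exact hX
  have hpc : p * coreIndicator x R l S ≤ p := mul_le_of_le_one_right hp0 h1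
  have : (1 - 1 / X) * (p * coreIndicator x R l S) ≤ p :=
    (mul_le_of_le_one_left (mul_nonneg hp0 h0) ha).trans hpc
  refine mul_le_mul_of_nonneg_left (by linarith) ?_
  have : 0 ≤ 1 - p := by linarith
  positivity

variable [Fintype H]

/-- The sum, over all placements `π` of the half-edges, of the square root of the partition
function; up to normalization, an expectation over partial random pairings. -/
noncomputable def sqrtMoment (p X : ℝ) (vtx : H → V) (R : Finset (H × H)) (A : Finset H) : ℝ :=
  ∑ π : Equiv.Perm H, √(gibbsSum p X (vtx ∘ π) R A)

lemma sqrtMoment_nonneg (p X : ℝ) (vtx : H → V) (R : Finset (H × H)) (A : Finset H) :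
    0 ≤ sqrtMoment p X vtx R A :=
  Finset.sum_nonneg fun _ _ => Real.sqrt_nonneg _

lemma exists_perm_fixing {Λ : Finset H} {i j i' j' : H} (hi : i ∈ Λ) (hj : j ∈ Λ) (hij : i ≠ j)
    (hi' : i' ∈ Λ) (hj' : j' ∈ Λ) (hij' : i' ≠ j') :
    ∃ τ : Equiv.Perm H, τ i = i' ∧ τ j = j' ∧ ∀ k, k ∉ Λ → τ k = k := by
  set j₁ := Equiv.swap i i' j with hj₁
  have hj₁Λ : j₁ ∈ Λ := by
    rw [hj₁, Equiv.swap_apply_def]; split_ifs <;> assumption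
  have hne : j₁ ≠ i' := by
    rw [hj₁, Ne, Equiv.swap_apply_eq_iff, Equiv.swap_apply_right]; exact hij.symm
  refine ⟨Equiv.swap j₁ j' * Equiv.swap i i', ?_, ?_, ?_⟩
  · rw [Equiv.Perm.mul_apply, Equiv.swap_apply_left, Equiv.swap_apply_of_ne_of_ne hne.symm hij']
  · rw [Equiv.Perm.mul_apply, ← hj₁, Equiv.swap_apply_left]
  · intro k hk
    have hne : ∀ a ∈ Λ, k ≠ a := fun a ha h => hk (h ▸ ha)
    rw [Equiv.Perm.mul_apply, Equiv.swap_apply_of_ne_of_ne (hne _ hi) (hne _ hi'),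
      Equiv.swap_apply_of_ne_of_ne (hne _ hj₁Λ) (hne _ hj')]

lemma sqrtMoment_insert_edge_eq (p X : ℝ) (vtx : H → V) {R : Finset (H × H)} {A Λ : Finset H}
    (hR : ∀ e ∈ R, e.1 ∉ Λ ∧ e.2 ∉ Λ) (hA : ∀ i ∈ A, i ∉ Λ) {i j i' j' : H} (hi : i ∈ Λ)
    (hj : j ∈ Λ) (hij : i ≠ j) (hi' : i' ∈ Λ) (hj' : j' ∈ Λ) (hij' : i' ≠ j') :
    sqrtMoment p X vtx (insert (i, j) R) A = sqrtMoment p X vtx (insert (i', j') R) A := by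
  obtain ⟨τ, rfl, rfl, hτ⟩ := exists_perm_fixing hi hj hij hi' hj' hij'
  unfold sqrtMoment
  rw [← Equiv.sum_comp (Equiv.mulRight τ)]
  refine Finset.sum_congr rfl fun π _ => ?_
  congr 1
  unfold gibbsSum groundSize
  refine Finset.sum_congr rfl fun S hS => ?_
  have hS' := Finset.mem_powerset.1 hS
  rw [penalizedCard_insert_edge _ (fun h => (hR _ h).1 hi),
    penalizedCard_insert_edge _ (fun h => (hR _ h).1 hi'),
    penalizedCard_congr (y := vtx ∘ π) (fun e he => ?_) (fun k hk => ?_)]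
  · rfl
  · simp [hτ _ (hR e he).1, hτ _ (hR e he).2]
  · simp [hτ _ (hA k (hS' hk))]

lemma sqrtMoment_insert_field_eq (p X : ℝ) (vtx : H → V) {R : Finset (H × H)} {A Λ : Finset H}
    (hR : ∀ e ∈ R, e.1 ∉ Λ ∧ e.2 ∉ Λ) (hA : ∀ i ∈ A, i ∉ Λ) {i i' : H} (hi : i ∈ Λ)
    (hi' : i' ∈ Λ) :
    sqrtMoment p X vtx R (insert i A) = sqrtMoment p X vtx R (insert i' A) := by
  have hne : ∀ k, k ∉ Λ → Equiv.swap i i' k = k := fun k hk =>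
    Equiv.swap_apply_of_ne_of_ne (fun h => hk (h ▸ hi)) (fun h => hk (h ▸ hi'))
  unfold sqrtMoment
  rw [← Equiv.sum_comp (Equiv.mulRight (Equiv.swap i i'))]
  refine Finset.sum_congr rfl fun π _ => ?_
  congr 1
  unfold gibbsSum groundSize
  have hiA : i ∉ A := fun h => hA _ h hi
  have hiA' : i' ∉ A := fun h => hA _ h hi'
  rw [Finset.sum_powerset_insert hiA, Finset.sum_powerset_insert hiA',
    Finset.card_insert_of_notMem hiA, Finset.card_insert_of_notMem hiA']
  have hcongr : ∀ S ∈ A.powerset,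
      penalizedCard (vtx ∘ (Equiv.mulRight (Equiv.swap i i') π)) R S =
        penalizedCard (vtx ∘ π) R S := fun S hS => by
    refine penalizedCard_congr (fun e he => ?_) (fun k hk => ?_)
    · simp [hne _ (hR e he).1, hne _ (hR e he).2]
    · simp [hne _ (hA k (Finset.mem_powerset.1 hS hk))]
  congr 1
  · exact Finset.sum_congr rfl fun S hS => by rw [hcongr S hS]
  · refine Finset.sum_congr rfl fun S hS => ?_
    have hS' := Finset.mem_powerset.1 hS
    rw [penalizedCard_insert_field _ _ (fun h => hiA (hS' h)),
      penalizedCard_insert_field _ _ (fun h => hiA' (hS' h)), hcongr S hS,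
      Finset.card_insert_of_notMem (fun h => hiA (hS' h)),
      Finset.card_insert_of_notMem (fun h => hiA' (hS' h))]
    simp

/-- One interpolation step: comparing an additional random edge with an additional field. -/
lemma sqrtMoment_step {p X β κ : ℝ} (hp0 : 0 ≤ p) (hp1 : p ≤ 1) (hX : 1 ≤ X)
    (hβ : β ^ 2 ≤ 1 - (1 - 1 / X) * p ^ 2) (vtx : H → V) {R : Finset (H × H)}
    {A Λ : Finset H} (hR : ∀ e ∈ R, e.1 ∉ Λ ∧ e.2 ∉ Λ) (hA : ∀ i ∈ A, i ∉ Λ) {i₀ j₀ l₀ : H}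
    (hi₀ : i₀ ∈ Λ) (hj₀ : j₀ ∈ Λ) (hij₀ : i₀ ≠ j₀) (hl₀ : l₀ ∈ Λ)
    (hκ : κ * Λ.card ≤ Λ.card - 1) :
    κ * sqrtMoment p X vtx (insert (i₀, j₀) R) A + β * sqrtMoment p X vtx R A ≤
      2 * sqrtMoment p X vtx R (insert l₀ A) := by
  have hX0 : X ≠ 0 := by linarith
  have ha0 : 0 ≤ 1 - 1 / X := by rw [sub_nonneg, div_le_one (by linarith)]; exact hX
  have ha1 : 1 - 1 / X < 1 := by have : 0 < 1 / X := by positivity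
                                 linarith
  set m : ℝ := (Λ.card : ℝ) with hm
  have hm0 : 0 < m := by rw [hm]; exact_mod_cast Finset.card_pos.2 ⟨_, hi₀⟩
  have hnR : ∀ i ∈ Λ, ∀ j, (i, j) ∉ R := fun i hi j h => (hR _ h).1 hi
  have hnA : ∀ l ∈ Λ, l ∉ A := fun l hl h => hA _ h hl
  have hpt : ∀ π : Equiv.Perm H,
      ∑ e ∈ Λ.offDiag, √(gibbsSum p X (vtx ∘ π) (insert e R) A) ≤
        2 * m * ∑ l ∈ Λ, √(gibbsSum p X (vtx ∘ π) R (insert l A)) -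
          m ^ 2 * (β * √(gibbsSum p X (vtx ∘ π) R A)) := by
    intro π
    have key := sum_sqrt_edge_le Λ A.powerset
      (fun S => p ^ S.card * (1 - p) ^ (A.card - S.card) * X ^ groundSize (vtx ∘ π) R S)
      (fun S _ => mul_nonneg (mul_nonneg (pow_nonneg hp0 _) (pow_nonneg (by linarith) _))
        (pow_nonneg (by linarith) _))
      (coreIndicator (vtx ∘ π) R) (coreIndicator_nonneg _ _) (coreIndicator_le_one _ _)
      ha0 ha1 hp0 hp1
    have h1 : ∑ e ∈ Λ.offDiag, √(gibbsSum p X (vtx ∘ π) (insert e R) A) ≤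
        ∑ i ∈ Λ, ∑ j ∈ Λ, √(gibbsSum p X (vtx ∘ π) (insert (i, j) R) A) := by
      rw [← Finset.sum_product']
      exact Finset.sum_le_sum_of_subset_of_nonneg
        (fun e he => by simp only [Finset.mem_offDiag] at he; simp [he.1, he.2.1])
        fun _ _ _ => Real.sqrt_nonneg _
    have h2 : ∑ i ∈ Λ, ∑ j ∈ Λ, √(gibbsSum p X (vtx ∘ π) (insert (i, j) R) A) =
        ∑ i ∈ Λ, ∑ j ∈ Λ, √(∑ S ∈ A.powerset,
          p ^ S.card * (1 - p) ^ (A.card - S.card) * X ^ groundSize (vtx ∘ π) R S *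
          (1 - (1 - 1 / X) *
            (coreIndicator (vtx ∘ π) R i S * coreIndicator (vtx ∘ π) R j S))) :=
      Finset.sum_congr rfl fun i hi => Finset.sum_congr rfl fun j _ => by
        rw [gibbsSum_insert_edge p hX0 _ (hnR i hi j)]
    have h3 : ∑ l ∈ Λ, √(gibbsSum p X (vtx ∘ π) R (insert l A)) =
        ∑ i ∈ Λ, √(∑ S ∈ A.powerset,
          p ^ S.card * (1 - p) ^ (A.card - S.card) * X ^ groundSize (vtx ∘ π) R S *
          (1 - (1 - 1 / X) * (p * coreIndicator (vtx ∘ π) R i S))) :=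
      Finset.sum_congr rfl fun i hi => by rw [gibbsSum_insert_field p hX0 _ _ (hnA i hi)]
    have h4 : β * √(gibbsSum p X (vtx ∘ π) R A) ≤
        √((1 - (1 - 1 / X) * p ^ 2) * gibbsSum p X (vtx ∘ π) R A) := by
      rw [Real.sqrt_mul ((sq_nonneg β).trans hβ)]
      exact mul_le_mul_of_nonneg_right (Real.le_sqrt_of_sq_le hβ) (Real.sqrt_nonneg _)
    have h5 := mul_le_mul_of_nonneg_left h4 (sq_nonneg m)
    rw [← h2, ← h3] at key
    change _ ≤ _ - m ^ 2 * √((1 - (1 - 1 / X) * p ^ 2) * gibbsSum p X (vtx ∘ π) R A) at key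
    linarith
  have hsum := Finset.sum_le_sum fun π (_ : π ∈ (Finset.univ : Finset (Equiv.Perm H))) => hpt π
  rw [Finset.sum_comm, Finset.sum_sub_distrib, ← Finset.mul_sum, ← Finset.mul_sum,
    ← Finset.mul_sum, Finset.sum_comm (s := Finset.univ) (t := Λ)] at hsum
  change ∑ e ∈ Λ.offDiag, sqrtMoment p X vtx (insert e R) A ≤
    2 * m * ∑ l ∈ Λ, sqrtMoment p X vtx R (insert l A) - m ^ 2 * (β * sqrtMoment p X vtx R A)
    at hsum
  have hedge : ∀ e ∈ Λ.offDiag, sqrtMoment p X vtx (insert e R) A =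
      sqrtMoment p X vtx (insert (i₀, j₀) R) A := by
    rintro ⟨i, j⟩ he
    simp only [Finset.mem_offDiag] at he
    exact sqrtMoment_insert_edge_eq p X vtx hR hA he.1 he.2.1 he.2.2 hi₀ hj₀ hij₀
  have hfield : ∀ l ∈ Λ, sqrtMoment p X vtx R (insert l A) =
      sqrtMoment p X vtx R (insert l₀ A) := fun l hl =>
    sqrtMoment_insert_field_eq p X vtx hR hA hl hl₀
  rw [Finset.sum_congr rfl hedge, Finset.sum_congr rfl hfield, Finset.sum_const,
    Finset.sum_const, Finset.offDiag_card, nsmul_eq_mul, nsmul_eq_mul,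
    Nat.cast_sub (Nat.le_mul_self _), Nat.cast_mul, ← hm] at hsum
  have hE := sqrtMoment_nonneg p X vtx (insert (i₀, j₀) R) A
  refine le_of_mul_le_mul_left (a := m * m) ?_ (by positivity)
  have := mul_le_mul_of_nonneg_right hκ (mul_nonneg hm0.le hE)
  nlinarith

end Interpolation

section PartialPairings

variable {N : ℕ}

/-- The first `r` of the pairs `(0, 1), (2, 3), …` of positions. -/
def pairSet (N r : ℕ) : Finset (Fin N × Fin N) :=
  Finset.univ.filter fun e => e.1.val % 2 = 0 ∧ e.2.val = e.1.val + 1 ∧ e.1.val < 2 * r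

/-- The last `f` positions. -/
def topSet (N f : ℕ) : Finset (Fin N) :=
  Finset.univ.filter fun i => N ≤ i.val + f

lemma pairSet_zero : pairSet N 0 = ∅ := by simp [pairSet]

lemma topSet_zero : topSet N 0 = ∅ := by
  ext i
  simp [topSet]

lemma topSet_self : topSet N N = Finset.univ := by simp [topSet]

lemma pairSet_succ {r : ℕ} (h : 2 * r + 1 < N) :
    pairSet N (r + 1) = insert (⟨2 * r, by omega⟩, ⟨2 * r + 1, h⟩) (pairSet N r) := by
  ext ⟨a, b⟩
  simp only [pairSet, Finset.mem_filter, Finset.mem_univ, true_and, Finset.mem_insert,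
    Prod.mk.injEq, Fin.ext_iff]
  omega

lemma topSet_succ {f : ℕ} (h : f < N) :
    topSet N (f + 1) = insert ⟨N - f - 1, by omega⟩ (topSet N f) := by
  ext a
  simp only [topSet, Finset.mem_filter, Finset.mem_univ, true_and, Finset.mem_insert,
    Fin.ext_iff]
  omega

lemma card_free (r f : ℕ) :
    (Finset.univ.filter fun i : Fin N => 2 * r ≤ i.val ∧ i.val + f < N).card =
      N - f - 2 * r := by
  rw [← Nat.card_Ico, ← Finset.card_map Fin.valEmbedding]
  congr 1
  ext a
  simp only [Finset.mem_map, Finset.mem_filter, Finset.mem_univ, true_and,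
    Fin.valEmbedding_apply, Finset.mem_Ico]
  constructor
  · rintro ⟨b, hb, rfl⟩
    omega
  · intro h
    exact ⟨⟨a, by omega⟩, by simp only; omega, rfl⟩

variable {V : Type*} [Fintype V] [DecidableEq V]

lemma sqrtMoment_pairSet_step {p X β : ℝ} (hp0 : 0 ≤ p) (hp1 : p ≤ 1) (hX : 1 ≤ X)
    (hβ : β ^ 2 ≤ 1 - (1 - 1 / X) * p ^ 2) (vtx : Fin N → V) {r f m : ℕ} (hm : 2 ≤ m)
    (h : m + f + 2 * r ≤ N) :
    (1 - 1 / m) * sqrtMoment p X vtx (pairSet N (r + 1)) (topSet N f) +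
        β * sqrtMoment p X vtx (pairSet N r) (topSet N f) ≤
      2 * sqrtMoment p X vtx (pairSet N r) (topSet N (f + 1)) := by
  rw [pairSet_succ (by omega), topSet_succ (by omega)]
  refine sqrtMoment_step hp0 hp1 hX hβ vtx
    (Λ := Finset.univ.filter fun i : Fin N => 2 * r ≤ i.val ∧ i.val + f < N)
    ?_ ?_ ?_ ?_ ?_ ?_ ?_
  · rintro ⟨a, b⟩ he
    simp only [pairSet, Finset.mem_filter, Finset.mem_univ, true_and] at he ⊢
    omega
  · intro i hi
    simp only [topSet, Finset.mem_filter, Finset.mem_univ, true_and] at hi ⊢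
    omega
  · simp only [Finset.mem_filter, Finset.mem_univ, true_and]
    omega
  · simp only [Finset.mem_filter, Finset.mem_univ, true_and]
    omega
  · simp [Fin.ext_iff]
  · simp only [Finset.mem_filter, Finset.mem_univ, true_and]
    omega
  · rw [card_free]
    have h1 : (m : ℝ) ≤ (N - f - 2 * r : ℕ) := by exact_mod_cast (by omega : m ≤ N - f - 2 * r)
    have h2 : (0 : ℝ) < m := by exact_mod_cast (by omega : 0 < m)
    have h3 : 1 ≤ 1 / (m : ℝ) * (N - f - 2 * r : ℕ) := by
      rw [one_div, ← div_eq_inv_mul, le_div_iff₀ h2]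
      linarith
    linarith

/-- Iterating the interpolation step along ballot paths. -/
lemma ballot_mul_sqrtMoment_le {p X β : ℝ} (hp0 : 0 ≤ p) (hp1 : p ≤ 1) (hX : 1 ≤ X)
    (hβ0 : 0 ≤ β) (hβ : β ^ 2 ≤ 1 - (1 - 1 / X) * p ^ 2) (vtx : Fin N → V) {R m : ℕ}
    (hm : 2 ≤ m) (h : m + 2 * R ≤ N) (f k : ℕ) (hf : f ≤ 2 * k) (hk : k ≤ R) :
    ((f.choose k : ℝ) - f.choose (k + 1)) * (1 - 1 / m) ^ k * β ^ f *
        sqrtMoment p X vtx (pairSet N R) (topSet N 0) ≤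
      2 ^ f * β ^ k * sqrtMoment p X vtx (pairSet N (R - k)) (topSet N f) := by
  have hM := sqrtMoment_nonneg p X vtx
  have hκ : (0 : ℝ) ≤ 1 - 1 / m := by
    rw [sub_nonneg, div_le_one (by positivity)]
    exact_mod_cast (by omega : 1 ≤ m)
  induction f generalizing k with
  | zero =>
    rcases k with _ | k
    · simp
    · simpa using mul_nonneg (pow_nonneg hβ0 _) (hM _ _)
  | succ f ih =>
    obtain ⟨k, rfl⟩ : ∃ j, k = j + 1 := ⟨k - 1, by omega⟩
    have hstep := sqrtMoment_pairSet_step hp0 hp1 hX hβ vtx hm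
      (r := R - (k + 1)) (f := f) (by omega)
    rw [show R - (k + 1) + 1 = R - k by omega] at hstep
    have ih1 := ih (k + 1) (by omega) hk
    have ih2 : ((f.choose k : ℝ) - f.choose (k + 1)) * (1 - 1 / m) ^ k * β ^ f *
        sqrtMoment p X vtx (pairSet N R) (topSet N 0) ≤
        2 ^ f * β ^ k * sqrtMoment p X vtx (pairSet N (R - k)) (topSet N f) := by
      rcases (by omega : f ≤ 2 * k ∨ f = 2 * k + 1) with hfk | hfk
      · exact ih k hfk (by omega)
      · have : f.choose k = f.choose (k + 1) := by
          rw [hfk, Nat.choose_symm_half]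
        rw [this, sub_self, zero_mul, zero_mul, zero_mul]
        exact mul_nonneg (mul_nonneg (by positivity) (pow_nonneg hβ0 _)) (hM _ _)
    rw [Nat.choose_succ_succ f k, Nat.choose_succ_succ f (k + 1)]
    push_cast
    have e1 := mul_le_mul_of_nonneg_left ih1 hβ0
    have e2 := mul_le_mul_of_nonneg_left ih2 (mul_nonneg hβ0 hκ)
    have e3 := mul_le_mul_of_nonneg_left hstep
      (mul_nonneg (pow_nonneg zero_le_two f) (pow_nonneg hβ0 (k + 1)))
    generalize sqrtMoment p X vtx (pairSet N R) (topSet N 0) = a at *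
    generalize (1 - 1 / (m : ℝ)) = κ at *
    refine le_trans (le_of_eq ?_) ((add_le_add e1 e2).trans ((le_of_eq ?_).trans
      (e3.trans (le_of_eq ?_)))) <;> ring

lemma sqrtMoment_pairSet_le {p X β : ℝ} (hp0 : 0 ≤ p) (hp1 : p ≤ 1) (hX : 1 ≤ X)
    (hβ0 : 0 < β) (hβ : β ^ 2 ≤ 1 - (1 - 1 / X) * p ^ 2) (vtx : Fin N → V) {R m : ℕ}
    (hm : 2 ≤ m) (hR : 0 < R) (h : m + 2 * R ≤ N) :
    ((1 - 1 / m) * β) ^ R * sqrtMoment p X vtx (pairSet N R) ∅ ≤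
      2 * R * (R + 1) * sqrtMoment p X vtx ∅ (topSet N (2 * R)) := by
  have hb := ballot_mul_sqrtMoment_le hp0 hp1 hX hβ0.le hβ vtx hm h (2 * R) R le_rfl le_rfl
  rw [Nat.sub_self, pairSet_zero, topSet_zero] at hb
  have hM := sqrtMoment_nonneg p X vtx (pairSet N R) ∅
  have hκ : (0 : ℝ) ≤ 1 - 1 / m := by
    rw [sub_nonneg, div_le_one (by positivity)]
    exact_mod_cast (by omega : 1 ≤ m)
  have hc1 : ((2 * R).choose (R + 1) : ℝ) * (R + 1) = (2 * R).choose R * R := by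
    have := Nat.choose_succ_right_eq (2 * R) R
    rw [show 2 * R - R = R by omega] at this
    exact_mod_cast this
  have hc2 : (4 : ℝ) ^ R ≤ 2 * R * (2 * R).choose R := by
    have := Nat.four_pow_le_two_mul_self_mul_centralBinom R hR
    rw [Nat.centralBinom_eq_two_mul_choose] at this
    exact_mod_cast this
  have hc3 : (4 : ℝ) ^ R ≤ 2 * R * (R + 1) *
      (((2 * R).choose R : ℝ) - (2 * R).choose (R + 1)) := by
    refine hc2.trans (le_of_eq ?_)
    linear_combination (2 * (R : ℝ)) * hc1
  have hpos : (0 : ℝ) < 4 ^ R * β ^ R := by positivity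
  refine le_of_mul_le_mul_left (a := 4 ^ R * β ^ R) ?_ hpos
  calc 4 ^ R * β ^ R * (((1 - 1 / m) * β) ^ R * sqrtMoment p X vtx (pairSet N R) ∅)
      ≤ (2 * R * (R + 1) * (((2 * R).choose R : ℝ) - (2 * R).choose (R + 1))) * β ^ R *
          (((1 - 1 / m) * β) ^ R * sqrtMoment p X vtx (pairSet N R) ∅) := by gcongr
    _ = 2 * R * (R + 1) * ((((2 * R).choose R : ℝ) - (2 * R).choose (R + 1)) *
          (1 - 1 / m) ^ R * β ^ (2 * R) * sqrtMoment p X vtx (pairSet N R) ∅) := by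
        rw [mul_pow]; ring
    _ ≤ 2 * R * (R + 1) * (2 ^ (2 * R) * β ^ R * sqrtMoment p X vtx ∅ (topSet N (2 * R))) := by
        gcongr
    _ = _ := by rw [pow_mul]; norm_num; ring

lemma gibbsSum_topSet_le {p X : ℝ} (hp0 : 0 ≤ p) (hp1 : p ≤ 1) (hX : 1 ≤ X) (x : Fin N → V)
    (R : Finset (Fin N × Fin N)) (f j : ℕ) (h : f + j = N) :
    (1 - p) ^ j * gibbsSum p X x R (topSet N f) ≤ gibbsSum p X x R Finset.univ := by
  induction j generalizing f with
  | zero => rw [← topSet_self, show f = N by omega]; simp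
  | succ j ih =>
    refine le_trans ?_ (ih (f + 1) (by omega))
    rw [pow_succ, mul_assoc, topSet_succ (by omega)]
    refine mul_le_mul_of_nonneg_left (gibbsSum_le_insert_field hp0 hp1 hX x R ?_)
      (pow_nonneg (by linarith) _)
    simp only [topSet, Finset.mem_filter, Finset.mem_univ, true_and]
    omega

lemma groundSize_empty_le {H : Type*} [DecidableEq H] (x : H → V) (S : Finset H) :
    groundSize x ∅ S ≤ (Finset.univ.filter fun v => ∀ i ∈ S, x i ≠ v).card := by
  refine Finset.sup_le fun I _ => ?_
  unfold penalizedCard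
  have h1 : I ⊆ (Finset.univ.filter fun v => ∀ i ∈ S, x i ≠ v) ∪
      (S.filter fun i => x i ∈ I).image x := by
    intro v hv
    simp only [Finset.mem_union, Finset.mem_filter, Finset.mem_univ, true_and, Finset.mem_image]
    by_cases h : ∀ i ∈ S, x i ≠ v
    · exact Or.inl h
    · push Not at h
      obtain ⟨i, hi, rfl⟩ := h
      exact Or.inr ⟨i, ⟨hi, hv⟩, rfl⟩
  have h2 := (Finset.card_le_card h1).trans (Finset.card_union_le _ _)
  have h3 : ((S.filter fun i => x i ∈ I).image x).card ≤ _ := Finset.card_image_le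
  simp only [Finset.filter_empty, Finset.card_empty, zero_add]
  omega

lemma gibbsSum_univ_le {H : Type*} [DecidableEq H] [Fintype H] {p X : ℝ} (hp0 : 0 ≤ p)
    (hp1 : p ≤ 1) (hX : 1 ≤ X) (x : H → V) {d : ℕ}
    (hx : ∀ v, (Finset.univ.filter fun i => x i = v).card = d) :
    gibbsSum p X x ∅ Finset.univ ≤ (1 + (X - 1) * (1 - p) ^ d) ^ Fintype.card V := by
  have hq : 0 ≤ 1 - p := by linarith
  set n := Fintype.card H
  calc gibbsSum p X x ∅ Finset.univ
      ≤ ∑ S ∈ (Finset.univ : Finset H).powerset, ∑ T : Finset V,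
          if ∀ i ∈ S, x i ∉ T then p ^ S.card * (1 - p) ^ (n - S.card) * (X - 1) ^ T.card
          else 0 := by
        refine Finset.sum_le_sum fun S _ => ?_
        calc _ ≤ p ^ S.card * (1 - p) ^ (n - S.card) *
              X ^ (Finset.univ.filter fun v => ∀ i ∈ S, x i ≠ v).card :=
              mul_le_mul_of_nonneg_left (pow_le_pow_right₀ hX (by convert groundSize_empty_le x S))
                (by positivity)
          _ = _ := by
            rw [← Finset.sum_filter, ← Finset.mul_sum]
            congr 1
            have := Finset.sum_pow_mul_eq_add_pow (X - 1) 1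
              (Finset.univ.filter fun v => ∀ i ∈ S, x i ≠ v)
            simp only [one_pow, mul_one, sub_add_cancel] at this
            rw [← this]
            refine Finset.sum_congr ?_ fun _ _ => rfl
            ext T
            simp only [Finset.mem_powerset, Finset.mem_filter, Finset.mem_univ, true_and,
              Finset.subset_iff]
            exact ⟨fun h i hi hT => h hT i hi rfl, fun h v hv i hi hiv => h i hi (hiv ▸ hv)⟩
    _ = ∑ T : Finset V, (X - 1) ^ T.card * ∑ S ∈ (Finset.univ.filter fun i => x i ∉ T).powerset,
          p ^ S.card * (1 - p) ^ (n - S.card) := by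
        rw [Finset.sum_comm]
        refine Finset.sum_congr rfl fun T _ => ?_
        rw [← Finset.sum_filter, Finset.mul_sum]
        refine Finset.sum_congr ?_ fun S _ => by ring
        ext S
        simp [Finset.subset_iff]
    _ = ∑ T : Finset V, (X - 1) ^ T.card * (1 - p) ^ (d * T.card) := by
        refine Finset.sum_congr rfl fun T _ => ?_
        congr 1
        have hcard : (Finset.univ.filter fun i => x i ∈ T).card = d * T.card := by
          rw [Finset.card_eq_sum_card_fiberwise (f := x) (t := T) (fun i hi => by simpa using hi),
            mul_comm, ← smul_eq_mul, ← Finset.sum_const]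
          refine Finset.sum_congr rfl fun v hv => ?_
          rw [← hx v]
          congr 1
          ext i
          simp only [Finset.mem_filter, Finset.mem_univ, true_and]
          exact ⟨fun h => h.2, fun h => ⟨h ▸ hv, h⟩⟩
        set B := Finset.univ.filter fun i => x i ∉ T with hB
        have hsplit : n = B.card + d * T.card := by
          have := Finset.card_filter_add_card_filter_not (s := (Finset.univ : Finset H))
            (fun i => x i ∈ T)
          rw [hcard, Finset.card_univ] at this
          rw [add_comm, hB]
          exact this.symm
        have := Finset.sum_pow_mul_eq_add_pow p (1 - p) B
        rw [show p + (1 - p) = 1 by ring, one_pow] at this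
        refine Eq.trans ?_ (one_mul ((1 - p) ^ (d * T.card)))
        refine Eq.trans ?_ (congrArg (· * (1 - p) ^ (d * T.card)) this)
        simp only [Finset.sum_mul]
        refine Finset.sum_congr rfl fun S hS => ?_
        have := Finset.card_le_card (Finset.mem_powerset.1 hS)
        rw [mul_assoc, ← pow_add]
        congr 2
        omega
    _ = _ := by
        have := Finset.sum_pow_mul_eq_add_pow ((X - 1) * (1 - p) ^ d) 1 (Finset.univ : Finset V)
        simp only [one_pow, mul_one, Finset.powerset_univ, Finset.card_univ] at this
        rw [add_comm 1, ← this]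
        refine Finset.sum_congr rfl fun T _ => ?_
        rw [mul_pow, ← pow_mul]

/-- The exponential moment bound for the penalized independence number of a random pairing. -/
lemma sqrtMoment_le {p X β : ℝ} (hp0 : 0 ≤ p) (hp1 : p < 1) (hX : 1 ≤ X)
    (hβ0 : 0 < β) (hβ : β ^ 2 ≤ 1 - (1 - 1 / X) * p ^ 2) (vtx : Fin N → V) {d : ℕ}
    (hx : ∀ v, (Finset.univ.filter fun i => vtx i = v).card = d) {n R s : ℕ}
    (hV : Fintype.card V = 2 * n) (hs : 1 ≤ s) (hR : 0 < R) (h : 2 * s + 2 * R = N) :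
    (1 - p) ^ s * ((1 - 1 / (2 * s : ℕ)) * β) ^ R * sqrtMoment p X vtx (pairSet N R) ∅ ≤
      2 * R * (R + 1) * N.factorial * (1 + (X - 1) * (1 - p) ^ d) ^ n := by
  have hq : 0 < 1 - p := by linarith
  have hw : 0 ≤ 1 + (X - 1) * (1 - p) ^ d := by
    have : 0 ≤ X - 1 := by linarith
    positivity
  have h1 := sqrtMoment_pairSet_le hp0 hp1.le hX hβ0 hβ vtx (m := 2 * s) (by omega) hR h.le
  have h2 : (1 - p) ^ s * sqrtMoment p X vtx ∅ (topSet N (2 * R)) ≤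
      N.factorial * (1 + (X - 1) * (1 - p) ^ d) ^ n := by
    unfold sqrtMoment
    rw [Finset.mul_sum]
    refine (Finset.sum_le_card_nsmul _ _ ((1 + (X - 1) * (1 - p) ^ d) ^ n) ?_).trans
      (le_of_eq ?_)
    · intro π _
      have hcard : ∀ v, (Finset.univ.filter fun i => (vtx ∘ π) i = v).card = d := by
        intro v
        rw [← hx v]
        exact Finset.card_bij (fun i _ => π i) (by simp) (by simp)
          fun b hb => ⟨π.symm b, by simpa using hb, by simp⟩
      refine (pow_le_pow_iff_left₀ (by positivity) (by positivity) two_ne_zero).1 ?_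
      rw [mul_pow, Real.sq_sqrt (gibbsSum_nonneg hp0 hp1.le (by linarith) _ _ _), ← pow_mul,
        ← pow_mul, mul_comm s, mul_comm n, ← hV]
      exact (gibbsSum_topSet_le hp0 hp1.le hX _ _ _ _ (by omega)).trans
        (gibbsSum_univ_le hp0 hp1.le hX _ hcard)
    · rw [Finset.card_univ, Fintype.card_perm, Fintype.card_fin, nsmul_eq_mul]
  calc _ = (1 - p) ^ s * (((1 - 1 / (2 * s : ℕ)) * β) ^ R *
        sqrtMoment p X vtx (pairSet N R) ∅) := by ring
    _ ≤ (1 - p) ^ s * (2 * R * (R + 1) * sqrtMoment p X vtx ∅ (topSet N (2 * R))) := by gcongr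
    _ = 2 * R * (R + 1) * ((1 - p) ^ s * sqrtMoment p X vtx ∅ (topSet N (2 * R))) := by ring
    _ ≤ 2 * R * (R + 1) * (N.factorial * (1 + (X - 1) * (1 - p) ^ d) ^ n) := by gcongr
    _ = _ := by ring

end PartialPairings

section ShortCycles

variable {V : Type*}

/-- `b` can be reached from `a` by a walk with at most `k` steps along the edges in `E`. -/
inductive ReachWithin (E : Multiset (Sym2 V)) : ℕ → V → V → Prop
  | refl (k : ℕ) (a : V) : ReachWithin E k a a
  | step {k : ℕ} {a b c : V} : s(a, b) ∈ E → ReachWithin E k b c → ReachWithin E (k + 1) a c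

namespace ReachWithin

variable {E E' : Multiset (Sym2 V)} {k l : ℕ} {a b c e₁ e₂ : V}

lemma mono (h : ReachWithin E k a b) (hE : E ⊆ E') (hk : k ≤ l) : ReachWithin E' l a b := by
  induction h generalizing l with
  | refl k a => exact refl l a
  | step h _ ih =>
    obtain ⟨l, rfl⟩ : ∃ j, l = j + 1 := ⟨l - 1, by omega⟩
    exact step (hE h) (ih (by omega))

lemma trans (h : ReachWithin E k a b) (h₂ : ReachWithin E l b c) :
    ReachWithin E (k + l) a c := by
  induction h with
  | refl k a => exact h₂.mono (fun _ h => h) (by omega)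
  | step h _ ih => exact ((step h (ih h₂)).mono (fun _ h => h) (by omega))

lemma symm (h : ReachWithin E k a b) : ReachWithin E k b a := by
  induction h with
  | refl k a => exact refl k a
  | step h _ ih => exact ih.trans (step (k := 0) (Sym2.eq_swap ▸ h) (refl 0 _))

lemma of_cons (h : ReachWithin (s(e₁, e₂) ::ₘ E) k a b) :
    ReachWithin E k a b ∨ ∃ s t, s + t + 1 ≤ k ∧
      (ReachWithin E s a e₁ ∧ ReachWithin E t e₂ b ∨
        ReachWithin E s a e₂ ∧ ReachWithin E t e₁ b) := by
  induction h with
  | refl k a => exact Or.inl (refl k a)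
  | @step k a b c h h' ih =>
    rcases Multiset.mem_cons.1 h with h | h
    · rcases Sym2.eq_iff.1 h with ⟨rfl, rfl⟩ | ⟨rfl, rfl⟩
      · rcases ih with ih | ⟨s, t, hst, ⟨_, h2⟩ | ⟨_, h2⟩⟩
        · exact Or.inr ⟨0, k, by omega, Or.inl ⟨refl 0 _, ih⟩⟩
        · exact Or.inr ⟨0, t, by omega, Or.inl ⟨refl 0 _, h2⟩⟩
        · exact Or.inl (h2.mono (fun _ h => h) (by omega))
      · rcases ih with ih | ⟨s, t, hst, ⟨_, h2⟩ | ⟨_, h2⟩⟩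
        · exact Or.inr ⟨0, k, by omega, Or.inr ⟨refl 0 _, ih⟩⟩
        · exact Or.inl (h2.mono (fun _ h => h) (by omega))
        · exact Or.inr ⟨0, t, by omega, Or.inr ⟨refl 0 _, h2⟩⟩
    · rcases ih with ih | ⟨s, t, hst, ⟨h1, h2⟩ | ⟨h1, h2⟩⟩
      · exact Or.inl (step h ih)
      · exact Or.inr ⟨s + 1, t, by omega, Or.inl ⟨step h h1, h2⟩⟩
      · exact Or.inr ⟨s + 1, t, by omega, Or.inr ⟨step h h1, h2⟩⟩

open Classical in
lemma card_le [Fintype V] {d : ℕ} (hE : ∀ a, (Finset.univ.filter fun b => s(a, b) ∈ E).card ≤ d)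
    (k : ℕ) (a : V) : (Finset.univ.filter (ReachWithin E k a)).card ≤ (d + 1) ^ k := by
  induction k generalizing a with
  | zero =>
    rw [pow_zero, Finset.card_le_one]
    intro b hb c hc
    simp only [Finset.mem_filter, Finset.mem_univ, true_and] at hb hc
    cases hb
    cases hc
    rfl
  | succ k ih =>
    have hsub : Finset.univ.filter (ReachWithin E (k + 1) a) ⊆
        insert a ((Finset.univ.filter fun b => s(a, b) ∈ E).biUnion
          fun b => Finset.univ.filter (ReachWithin E k b)) := by
      intro c hc
      simp only [Finset.mem_filter, Finset.mem_univ, true_and, Finset.mem_insert,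
        Finset.mem_biUnion] at hc ⊢
      cases hc with
      | refl => exact Or.inl rfl
      | step h h' => exact Or.inr ⟨_, h, h'⟩
    refine (Finset.card_le_card hsub).trans ((Finset.card_insert_le _ _).trans ?_)
    have h1 := Finset.card_biUnion_le_card_mul (Finset.univ.filter fun b => s(a, b) ∈ E)
      (fun b => Finset.univ.filter (ReachWithin E k b)) _ fun b _ => ih b
    have h2 := Nat.mul_le_mul_right ((d + 1) ^ k) (hE a)
    have h3 : 1 ≤ (d + 1) ^ k := Nat.one_le_pow _ _ (by omega)
    rw [pow_succ]
    linarith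

end ReachWithin

/-- No edge of the multigraph `E` lies on a closed walk of length at most `g + 1` that uses it
only once; in particular, all cycles (including loops and double edges) are longer than `g + 1`. -/
def NoShortCycle [DecidableEq V] (g : ℕ) (E : Multiset (Sym2 V)) : Prop :=
  ∀ a b, s(a, b) ∈ E → ¬ ReachWithin (E.erase s(a, b)) g a b

section

variable [DecidableEq V] {g : ℕ} {E E' : Multiset (Sym2 V)} {a b u v : V}

lemma NoShortCycle.mono (h : NoShortCycle g E) (hE : E' ≤ E) : NoShortCycle g E' :=
  fun a b hab hr => h a b (Multiset.mem_of_le hE hab)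
    (hr.mono (Multiset.subset_of_le (Multiset.erase_le_erase _ hE)) le_rfl)

lemma NoShortCycle.cons (h : NoShortCycle g E) (hab : ¬ ReachWithin E g a b) :
    NoShortCycle g (s(a, b) ::ₘ E) := by
  intro c d hcd hr
  by_cases heq : s(c, d) = s(a, b)
  · rw [heq, Multiset.erase_cons_head] at hr
    rcases Sym2.eq_iff.1 heq with ⟨rfl, rfl⟩ | ⟨rfl, rfl⟩
    · exact hab hr
    · exact hab hr.symm
  · have hcdE : s(c, d) ∈ E := (Multiset.mem_cons.1 hcd).resolve_left heq
    rw [Multiset.erase_cons_tail E (Ne.symm heq)] at hr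
    have hsub : E.erase s(c, d) ⊆ E := Multiset.erase_subset _ _
    rcases hr.of_cons with hr | ⟨s, t, hst, ⟨h1, h2⟩ | ⟨h1, h2⟩⟩
    · exact h c d hcdE hr
    · refine hab (((h1.symm.mono hsub le_rfl).trans
        (ReachWithin.step hcdE (h2.symm.mono hsub le_rfl))).mono (fun _ h => h) (by omega))
    · refine hab (((h2.mono hsub le_rfl).trans (ReachWithin.step (Sym2.eq_swap ▸ hcdE)
        (h1.mono hsub le_rfl))).mono (fun _ h => h) (by omega))

/-- Splicing the edge `uv` into the edge `ab`. -/
lemma NoShortCycle.splice (h : NoShortCycle g (s(a, b) ::ₘ E))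
    (hua : ¬ ReachWithin (s(a, b) ::ₘ E) g u a) (hub : ¬ ReachWithin (s(a, b) ::ₘ E) g u b)
    (hva : ¬ ReachWithin (s(a, b) ::ₘ E) g v a) :
    NoShortCycle g (s(a, v) ::ₘ s(u, b) ::ₘ E) := by
  have hsub : E ⊆ s(a, b) ::ₘ E := Multiset.subset_cons _ _
  refine ((h.mono (Multiset.le_cons_self _ _)).cons fun hr => hub (hr.mono hsub le_rfl)).cons ?_
  intro hr
  rcases hr.of_cons with hr | ⟨s, t, hst, ⟨h1, h2⟩ | ⟨h1, h2⟩⟩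
  · exact hva (hr.symm.mono hsub le_rfl)
  · exact hua (h1.symm.mono hsub (by omega))
  · refine h a b (Multiset.mem_cons_self _ _) ?_
    rw [Multiset.erase_cons_head]
    exact h1.mono (fun _ h => h) (by omega)

end

end ShortCycles

section RandomPairing

/-- The position paired with `i`. -/
def partner {M : ℕ} (i : Fin (2 * M)) : Fin (2 * M) :=
  ⟨if i.val % 2 = 0 then i.val + 1 else i.val - 1, by split_ifs <;> omega⟩

lemma partner_val {M : ℕ} (i : Fin (2 * M)) :
    (partner i).val = if i.val % 2 = 0 then i.val + 1 else i.val - 1 := rfl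

lemma partner_partner {M : ℕ} (i : Fin (2 * M)) : partner (partner i) = i := by
  ext
  simp only [partner_val]
  split_ifs <;> omega

lemma partner_involutive {M : ℕ} : Function.Involutive (partner (M := M)) := partner_partner

lemma partner_ne {M : ℕ} (i : Fin (2 * M)) : partner i ≠ i := by
  rw [Ne, Fin.ext_iff, partner_val]
  split_ifs <;> omega

variable {M : ℕ} {V : Type*}

lemma partner_of_mem_pairSet {r : ℕ} {e : Fin (2 * M) × Fin (2 * M)}
    (he : e ∈ pairSet (2 * M) r) : e.2 = partner e.1 ∧ e.1 = partner e.2 := by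
  simp only [pairSet, Finset.mem_filter, Finset.mem_univ, true_and] at he
  simp only [Fin.ext_iff, partner_val]
  split_ifs <;> omega

/-- The edges of the multigraph obtained by joining the vertices assigned to each pair. -/
def pairEdges {H : Type*} (x : H → V) (P : Finset (H × H)) : Multiset (Sym2 V) :=
  P.val.map fun e => s(x e.1, x e.2)

lemma pairEdges_insert {H : Type*} [DecidableEq H] (x : H → V) {P : Finset (H × H)} {e : H × H}
    (he : e ∉ P) : pairEdges x (insert e P) = s(x e.1, x e.2) ::ₘ pairEdges x P := by
  rw [pairEdges, Finset.insert_val_of_notMem he, Multiset.map_cons, pairEdges]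

lemma pairEdges_congr {H : Type*} {x y : H → V} {P : Finset (H × H)}
    (h : ∀ e ∈ P, x e.1 = y e.1 ∧ x e.2 = y e.2) : pairEdges x P = pairEdges y P :=
  Multiset.map_congr rfl fun e he => by rw [(h e he).1, (h e he).2]

lemma exists_of_mem_pairEdges {r : ℕ} {x : Fin (2 * M) → V} {a b : V}
    (h : s(a, b) ∈ pairEdges x (pairSet (2 * M) r)) : ∃ i, x i = a ∧ x (partner i) = b := by
  obtain ⟨e, he, heq⟩ := Multiset.mem_map.1 h
  obtain ⟨h1, h2⟩ := partner_of_mem_pairSet he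
  rcases Sym2.eq_iff.1 heq with ⟨ha, hb⟩ | ⟨ha, hb⟩
  · exact ⟨e.1, ha, h1 ▸ hb⟩
  · exact ⟨e.2, hb, h2 ▸ ha⟩

variable [DecidableEq V]

open Classical in
/-- Transposing one end of the next pair with a position `l` outside of a few balls keeps the
multigraph free of short cycles. -/
lemma noShortCycle_comp_swap {g j : ℕ} (hj : j < M) (x : Fin (2 * M) → V)
    (hx : NoShortCycle g (pairEdges x (pairSet (2 * M) j))) {h₀ h₁ : Fin (2 * M)}
    (hh₀ : h₀.val = 2 * j) (hh₁ : h₁.val = 2 * j + 1) (l : Fin (2 * M))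
    (hu : ¬ ReachWithin (pairEdges x (pairSet (2 * M) j)) g (x h₀) (x l))
    (hu' : ¬ ReachWithin (pairEdges x (pairSet (2 * M) j)) g (x h₀) (x (partner l)))
    (hv : ¬ ReachWithin (pairEdges x (pairSet (2 * M) j)) g (x h₁) (x l)) :
    NoShortCycle g (pairEdges (x ∘ Equiv.swap h₀ l) (pairSet (2 * M) (j + 1))) := by
  have hsucc : pairSet (2 * M) (j + 1) = insert (h₀, h₁) (pairSet (2 * M) j) := by
    rw [pairSet_succ (by omega)]
    congr 2 <;> ext <;> simp [hh₀, hh₁]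
  have hl₁ : l ≠ h₁ := by
    rintro rfl
    exact hv (ReachWithin.refl _ _)
  have h01 : h₁ ≠ h₀ := by
    rw [Ne, Fin.ext_iff]
    omega
  rw [hsucc, pairEdges_insert _ (by simp [pairSet, hh₀])]
  simp only [Function.comp_apply, Equiv.swap_apply_left, Equiv.swap_apply_of_ne_of_ne h01 hl₁.symm]
  by_cases hlj : l.val < 2 * j
  · obtain ⟨e, he, hcase⟩ : ∃ e ∈ pairSet (2 * M) j,
        e.1 = l ∧ e.2 = partner l ∨ e.2 = l ∧ e.1 = partner l := by
      by_cases hpar : l.val % 2 = 0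
      · refine ⟨(l, partner l), ?_, Or.inl ⟨rfl, rfl⟩⟩
        simp only [pairSet, Finset.mem_filter, Finset.mem_univ, true_and, partner_val]
        split_ifs
        omega
      · refine ⟨(partner l, l), ?_, Or.inr ⟨rfl, rfl⟩⟩
        simp only [pairSet, Finset.mem_filter, Finset.mem_univ, true_and, partner_val]
        split_ifs
        omega
    obtain ⟨P, heP, hP⟩ : ∃ P, e ∉ P ∧ pairSet (2 * M) j = insert e P :=
      ⟨(pairSet (2 * M) j).erase e, by simp, (Finset.insert_erase he).symm⟩
    have hlP : partner l ≠ h₀ := by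
      intro h
      have := congrArg Fin.val h
      rw [partner_val, hh₀] at this
      split_ifs at this <;> omega
    have h1 : pairEdges x (pairSet (2 * M) j) = s(x l, x (partner l)) ::ₘ pairEdges x P := by
      rw [hP, pairEdges_insert _ heP]
      rcases hcase with ⟨h1, h2⟩ | ⟨h1, h2⟩
      · rw [h1, h2]
      · rw [h1, h2, Sym2.eq_swap]
    have h2 : pairEdges (x ∘ Equiv.swap h₀ l) (pairSet (2 * M) j) =
        s(x h₀, x (partner l)) ::ₘ pairEdges x P := by
      have hcongr : pairEdges (x ∘ Equiv.swap h₀ l) P = pairEdges x P := by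
        refine pairEdges_congr fun e' he' => ?_
        have hmem : e' ∈ pairSet (2 * M) j := by
          rw [hP]
          exact Finset.mem_insert_of_mem he'
        have hne : e' ≠ e := fun h => heP (h ▸ he')
        have hp := partner_of_mem_pairSet he
        have hp' := partner_of_mem_pairSet hmem
        simp only [pairSet, Finset.mem_filter, Finset.mem_univ, true_and] at he hmem
        simp only [Function.comp_apply]
        rw [Ne, Prod.ext_iff, Fin.ext_iff, Fin.ext_iff] at hne
        have hcase' : e.1.val = l.val ∨ e.2.val = l.val := by
          rcases hcase with h | h
          · exact Or.inl (congrArg _ h.1)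
          · exact Or.inr (congrArg _ h.1)
        rw [Equiv.swap_apply_of_ne_of_ne, Equiv.swap_apply_of_ne_of_ne]
        · exact ⟨rfl, rfl⟩
        all_goals
          rw [Ne, Fin.ext_iff]
          omega
      rw [hP, pairEdges_insert _ heP, hcongr]
      simp only [Function.comp_apply]
      rcases hcase with ⟨h1, h2⟩ | ⟨h1, h2⟩
      · rw [h1, h2, Equiv.swap_apply_right,
          Equiv.swap_apply_of_ne_of_ne hlP (partner_ne l)]
      · rw [h1, h2, Equiv.swap_apply_right,
          Equiv.swap_apply_of_ne_of_ne hlP (partner_ne l), Sym2.eq_swap]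
    rw [h2]
    rw [h1] at hx hu hu' hv
    exact hx.splice hu hu' hv
  · have h2 : pairEdges (x ∘ Equiv.swap h₀ l) (pairSet (2 * M) j) =
        pairEdges x (pairSet (2 * M) j) := by
      refine pairEdges_congr fun e he => ?_
      simp only [pairSet, Finset.mem_filter, Finset.mem_univ, true_and] at he
      simp only [Function.comp_apply]
      rw [Equiv.swap_apply_of_ne_of_ne, Equiv.swap_apply_of_ne_of_ne]
      · exact ⟨rfl, rfl⟩
      all_goals
        rw [Ne, Fin.ext_iff]
        omega
    rw [h2]
    exact hx.cons fun h => hv h.symm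

variable [Fintype V]

omit [Fintype V] in
lemma card_preimage_le {H : Type*} [Fintype H] {x : H → V} {d : ℕ}
    (hx : ∀ v, (Finset.univ.filter fun i => x i = v).card ≤ d) (S : Finset V) :
    (Finset.univ.filter fun i => x i ∈ S).card ≤ d * S.card := by
  rw [Finset.card_eq_sum_card_fiberwise (f := x) (t := S) (fun i hi => by simpa using hi),
    mul_comm, ← smul_eq_mul, ← Finset.sum_const]
  refine Finset.sum_le_sum fun v _ => (Finset.card_le_card ?_).trans (hx v)
  intro i
  simp +contextual

open Classical in
lemma card_bad_swap_le {g j d : ℕ} (hj : j < M) (x : Fin (2 * M) → V)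
    (hd : ∀ v, (Finset.univ.filter fun i => x i = v).card ≤ d)
    (hx : NoShortCycle g (pairEdges x (pairSet (2 * M) j))) {h₀ h₁ : Fin (2 * M)}
    (hh₀ : h₀.val = 2 * j) (hh₁ : h₁.val = 2 * j + 1) :
    (Finset.univ.filter fun l => ¬ NoShortCycle g
      (pairEdges (x ∘ Equiv.swap h₀ l) (pairSet (2 * M) (j + 1)))).card ≤
      3 * d * (d + 1) ^ g := by
  set E := pairEdges x (pairSet (2 * M) j)
  have hdeg : ∀ a, (Finset.univ.filter fun b => s(a, b) ∈ E).card ≤ d := by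
    intro a
    refine (Finset.card_le_card (t := (Finset.univ.filter fun i => x i = a).image
      (x ∘ partner)) ?_).trans (Finset.card_image_le.trans (hd a))
    intro b hb
    simp only [Finset.mem_filter, Finset.mem_univ, true_and, Finset.mem_image,
      Function.comp_apply] at hb ⊢
    exact exists_of_mem_pairEdges hb
  have hball : ∀ u, (Finset.univ.filter fun l => ReachWithin E g u (x l)).card ≤
      d * (d + 1) ^ g := by
    intro u
    have h := card_preimage_le hd (Finset.univ.filter (ReachWithin E g u))
    simp only [Finset.mem_filter, Finset.mem_univ, true_and] at h
    exact h.trans (Nat.mul_le_mul_left _ (ReachWithin.card_le (fun a => by convert hdeg a) g u))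
  have hball' : ∀ u, (Finset.univ.filter fun l => ReachWithin E g u (x (partner l))).card ≤
      d * (d + 1) ^ g := by
    intro u
    refine (Finset.card_le_card_of_injOn partner (fun l hl => ?_)
      fun a _ b _ h => ?_).trans (hball u)
    · simpa using hl
    · rw [← partner_partner a, h, partner_partner]
  have hsub : (Finset.univ.filter fun l => ¬ NoShortCycle g
      (pairEdges (x ∘ Equiv.swap h₀ l) (pairSet (2 * M) (j + 1)))) ⊆
      (Finset.univ.filter fun l => ReachWithin E g (x h₀) (x l)) ∪
      ((Finset.univ.filter fun l => ReachWithin E g (x h₀) (x (partner l))) ∪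
      (Finset.univ.filter fun l => ReachWithin E g (x h₁) (x l))) := by
    intro l hl
    simp only [Finset.mem_filter, Finset.mem_univ, true_and, Finset.mem_union] at hl ⊢
    contrapose! hl
    exact noShortCycle_comp_swap hj x hx hh₀ hh₁ l hl.1 hl.2.1 hl.2.2
  refine (Finset.card_le_card hsub).trans ?_
  have h1 := hball (x h₀)
  have h2 := hball' (x h₀)
  have h3 := hball (x h₁)
  have h4 := Finset.card_union_le (Finset.univ.filter fun l => ReachWithin E g (x h₀) (x l))
    ((Finset.univ.filter fun l => ReachWithin E g (x h₀) (x (partner l))) ∪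
      (Finset.univ.filter fun l => ReachWithin E g (x h₁) (x l)))
  have h5 := Finset.card_union_le
    (Finset.univ.filter fun l => ReachWithin E g (x h₀) (x (partner l)))
    (Finset.univ.filter fun l => ReachWithin E g (x h₁) (x l))
  linarith

open Classical in
/-- The permutations of the positions whose first `j` pairs form no short cycle. -/
noncomputable def goodPerms (vtx : Fin (2 * M) → V) (g j : ℕ) :
    Finset (Equiv.Perm (Fin (2 * M))) :=
  Finset.univ.filter fun π => NoShortCycle g (pairEdges (vtx ∘ π) (pairSet (2 * M) j))

omit [Fintype V] in
lemma mem_goodPerms {vtx : Fin (2 * M) → V} {g j : ℕ} {π : Equiv.Perm (Fin (2 * M))} :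
    π ∈ goodPerms vtx g j ↔ NoShortCycle g (pairEdges (vtx ∘ π) (pairSet (2 * M) j)) := by
  simp [goodPerms]

lemma card_goodPerms_step (vtx : Fin (2 * M) → V) {g j d : ℕ} (hj : j < M)
    (hd : ∀ v, (Finset.univ.filter fun i => vtx i = v).card ≤ d) :
    (goodPerms vtx g j).card * (2 * M - (3 * d * (d + 1) ^ g)) ≤
      2 * M * (goodPerms vtx g (j + 1)).card := by
  classical
  set h₀ : Fin (2 * M) := ⟨2 * j, by omega⟩
  set h₁ : Fin (2 * M) := ⟨2 * j + 1, by omega⟩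
  have hdc := Finset.card_mul_le_card_mul (s := goodPerms vtx g j)
    (t := (Finset.univ : Finset (Fin (2 * M))))
    (fun π l => π * Equiv.swap h₀ l ∈ goodPerms vtx g (j + 1))
    (m := 2 * M - (3 * d * (d + 1) ^ g)) (n := (goodPerms vtx g (j + 1)).card) ?_ ?_
  · simpa using hdc
  · intro π hπ
    have hd' : ∀ v, (Finset.univ.filter fun i => (vtx ∘ π) i = v).card ≤ d := by
      intro v
      refine le_trans (le_of_eq ?_) (hd v)
      exact Finset.card_bij (fun i _ => π i) (by simp) (by simp)
        fun b hb => ⟨π.symm b, by simpa using hb, by simp⟩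
    have hbad := card_bad_swap_le hj (vtx ∘ π) hd' (mem_goodPerms.1 hπ)
      (h₀ := h₀) (h₁ := h₁) rfl rfl
    have hsum := Finset.card_filter_add_card_filter_not (s := (Finset.univ : Finset (Fin (2 * M))))
      (fun l => NoShortCycle g (pairEdges ((vtx ∘ π) ∘ Equiv.swap h₀ l)
        (pairSet (2 * M) (j + 1))))
    rw [Finset.card_univ, Fintype.card_fin] at hsum
    simp only [Finset.bipartiteAbove, mem_goodPerms, Equiv.Perm.coe_mul, ← Function.comp_assoc]
    omega
  · intro l _
    refine Finset.card_le_card_of_injOn (fun π => π * Equiv.swap h₀ l) ?_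
      fun a _ b _ h => mul_right_cancel h
    intro π hπ
    simpa [Finset.bipartiteBelow] using (Finset.mem_filter.1 hπ).2

lemma factorial_mul_pow_le_card_goodPerms (vtx : Fin (2 * M) → V) {g d : ℕ}
    (hd : ∀ v, (Finset.univ.filter fun i => vtx i = v).card ≤ d) {η : ℝ} (hη : η ≤ 1)
    (hM : (3 * d * (d + 1) ^ g : ℕ) ≤ η * (2 * M)) :
    (2 * M).factorial * (1 - η) ^ M ≤ ((goodPerms vtx g M).card : ℝ) := by
  suffices h : ∀ j ≤ M, (2 * M).factorial * (1 - η) ^ j ≤ ((goodPerms vtx g j).card : ℝ) from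
    h M le_rfl
  intro j hj
  induction j with
  | zero =>
    have : goodPerms vtx g 0 = Finset.univ := by
      ext π
      simp [mem_goodPerms, pairSet_zero, pairEdges, NoShortCycle]
    rw [this, Finset.card_univ, Fintype.card_perm, Fintype.card_fin]
    simp
  | succ j ih =>
    have ih := ih (by omega)
    have hMpos : (0 : ℝ) < 2 * M := by
      have : (0 : ℝ) < M := by exact_mod_cast (by omega : 0 < M)
      linarith
    have hstep : ((goodPerms vtx g j).card : ℝ) * (2 * M - (3 * d * (d + 1) ^ g : ℕ)) ≤
        2 * M * (goodPerms vtx g (j + 1)).card := by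
      have h := card_goodPerms_step vtx (g := g) (by omega : j < M) hd
      rw [← Nat.cast_le (α := ℝ)] at h
      push_cast at h
      refine le_trans ?_ h
      push_cast
      refine mul_le_mul_of_nonneg_left ?_ (Nat.cast_nonneg _)
      have := le_tsub_add (b := 2 * M) (a := 3 * d * (d + 1) ^ g)
      have : ((2 * M : ℕ) : ℝ) ≤ ((2 * M - (3 * d * (d + 1) ^ g) : ℕ) : ℝ) +
        (3 * d * (d + 1) ^ g : ℕ) := by exact_mod_cast this
      push_cast at this
      linarith
    have h1 : (1 - η) * (2 * M) ≤ 2 * M - (3 * d * (d + 1) ^ g : ℕ) := by linarith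
    have hq : 0 ≤ 1 - η := by linarith
    refine le_of_mul_le_mul_left ?_ hMpos
    calc 2 * M * ((2 * M).factorial * (1 - η) ^ (j + 1))
        = ((2 * M).factorial * (1 - η) ^ j) * ((1 - η) * (2 * M)) := by rw [pow_succ]; ring
      _ ≤ (goodPerms vtx g j).card * ((1 - η) * (2 * M)) := by gcongr
      _ ≤ (goodPerms vtx g j).card * (2 * M - (3 * d * (d + 1) ^ g : ℕ)) := by gcongr
      _ ≤ _ := hstep

end RandomPairing

section PairingGraph

variable {V H : Type*}

/-- The graph joining `x h` and `x (ι h)` for all half-edges `h`, where `ι` is an involution. -/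
def pairingGraph (ι : H → H) (hι : Function.Involutive ι) (x : H → V) : SimpleGraph V where
  Adj u v := u ≠ v ∧ ∃ h, x h = u ∧ x (ι h) = v
  symm := ⟨fun _ _ ⟨hne, h, hu, hv⟩ => ⟨hne.symm, ι h, hv, by rw [hι h, hu]⟩⟩
  loopless := ⟨fun _ h => h.1 rfl⟩

/-- The pairing has neither loops nor multiple edges. -/
def IsSimplePairing (ι : H → H) (x : H → V) : Prop :=
  (∀ h, x h ≠ x (ι h)) ∧ Function.Injective fun h => (x h, x (ι h))

variable {ι : H → H} {hι : Function.Involutive ι} {x : H → V}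

lemma pairingGraph_adj_iff (hx : IsSimplePairing ι x) {u v : V} :
    (pairingGraph ι hι x).Adj u v ↔ ∃ h, x h = u ∧ x (ι h) = v := by
  refine ⟨fun h => h.2, ?_⟩
  rintro ⟨h, rfl, rfl⟩
  exact ⟨hx.1 h, h, rfl, rfl⟩

lemma ncard_neighborSet_pairingGraph [Fintype H] [DecidableEq V] (hx : IsSimplePairing ι x)
    (v : V) : ((pairingGraph ι hι x).neighborSet v).ncard =
      (Finset.univ.filter fun h => x h = v).card := by
  rw [← Set.ncard_coe_finset]
  refine (Set.ncard_congr (fun h _ => x (ι h)) ?_ ?_ ?_).symm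
  · intro h hh
    exact (pairingGraph_adj_iff (hι := hι) hx).2 ⟨h, by simpa using hh, rfl⟩
  · intro a b ha hb hab
    simp only [Finset.coe_filter, Finset.mem_univ, true_and, Set.mem_ofPred_eq] at ha hb
    exact hx.2 (Prod.ext (ha.trans hb.symm) hab)
  · intro u hu
    obtain ⟨h, hh, rfl⟩ := (pairingGraph_adj_iff (hι := hι) hx).1 hu
    exact ⟨h, by simpa using hh, rfl⟩

/-- All graphs that arise from simple pairings arise from the same number of them. -/
lemma card_simplePairing_eq [Finite H] (vtx : H → V) (π₀ : Equiv.Perm H)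
    (h₀ : IsSimplePairing ι (vtx ∘ π₀)) :
    Nat.card {π : Equiv.Perm H // IsSimplePairing ι (vtx ∘ π) ∧
      pairingGraph ι hι (vtx ∘ π) = pairingGraph ι hι (vtx ∘ π₀)} =
    Nat.card ({τ : Equiv.Perm H // vtx ∘ τ = vtx} ×
      {σ : Equiv.Perm H // ∀ h, σ (ι h) = ι (σ h)}) := by
  have hmem : ∀ τ σ : Equiv.Perm H, vtx ∘ τ = vtx → (∀ h, σ (ι h) = ι (σ h)) →
      IsSimplePairing ι (vtx ∘ (τ * π₀ * σ)) ∧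
        pairingGraph ι hι (vtx ∘ (τ * π₀ * σ)) = pairingGraph ι hι (vtx ∘ π₀) := by
    intro τ σ hτ hσ
    have hcomp : vtx ∘ (τ * π₀ * σ) = (vtx ∘ π₀) ∘ σ := by
      rw [Equiv.Perm.coe_mul, Equiv.Perm.coe_mul, ← Function.comp_assoc, ← Function.comp_assoc, hτ]
    have hs : IsSimplePairing ι ((vtx ∘ π₀) ∘ σ) := by
      refine ⟨fun h => ?_, fun a b hab => ?_⟩
      · simp only [Function.comp_apply (f := vtx ∘ π₀), hσ]
        exact h₀.1 _
      · simp only [Function.comp_apply (f := vtx ∘ π₀), hσ] at hab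
        exact σ.injective (h₀.2 hab)
    rw [hcomp]
    refine ⟨hs, ?_⟩
    ext u v
    rw [pairingGraph_adj_iff hs, pairingGraph_adj_iff h₀]
    simp only [Function.comp_apply (f := vtx ∘ π₀), hσ]
    exact σ.surjective.exists (p := fun h => (vtx ∘ π₀) h = u ∧ (vtx ∘ π₀) (ι h) = v) |>.symm
  refine (Nat.card_congr (Equiv.ofBijective
    (fun p => ⟨p.1.1 * π₀ * p.2.1, hmem _ _ p.1.2 p.2.2⟩) ⟨?_, ?_⟩)).symm
  · rintro ⟨⟨τ, hτ⟩, σ, hσ⟩ ⟨⟨τ', hτ'⟩, σ', hσ'⟩ heq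
    simp only [Subtype.mk.injEq] at heq
    have hv : ∀ h, (vtx ∘ π₀) (σ h) = (vtx ∘ π₀) (σ' h) := by
      intro h
      have h1 := congrFun hτ (π₀ (σ h))
      have h2 := congrFun hτ' (π₀ (σ' h))
      have h3 := congrArg vtx (Equiv.congr_fun heq h)
      simp only [Equiv.Perm.mul_apply, Function.comp_apply] at h1 h2 h3 ⊢
      rw [← h1, ← h2, h3]
    have hσσ : σ = σ' := by
      ext h
      refine h₀.2 (Prod.ext (hv h) ?_)
      simp only [← hσ, ← hσ']
      exact hv (ι h)
    subst hσσ
    have : τ = τ' := mul_right_cancel (mul_right_cancel heq)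
    subst this
    rfl
  · rintro ⟨π, hπ, hG⟩
    have hex : ∀ h, ∃ h', (vtx ∘ π₀) h' = (vtx ∘ π) h ∧ (vtx ∘ π₀) (ι h') = (vtx ∘ π) (ι h) := by
      intro h
      rw [← pairingGraph_adj_iff (hι := hι) h₀, ← hG, pairingGraph_adj_iff hπ]
      exact ⟨h, rfl, rfl⟩
    choose s hs hs' using hex
    have hinj : Function.Injective s := by
      intro a b hab
      refine hπ.2 (Prod.ext ?_ ?_)
      · simp only [← hs, hab]
      · simp only [← hs', hab]
    let σ : Equiv.Perm H := Equiv.ofBijective s (Finite.injective_iff_bijective.1 hinj)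
    have hσ : ∀ h, σ h = s h := fun _ => rfl
    refine ⟨⟨⟨π * σ⁻¹ * π₀⁻¹, ?_⟩, σ, ?_⟩, ?_⟩
    · funext y
      obtain ⟨h, rfl⟩ : ∃ h, π₀ (σ h) = y := ⟨σ⁻¹ (π₀⁻¹ y), by simp⟩
      have := hs h
      rw [← hσ] at this
      simpa using this.symm
    · intro h
      refine h₀.2 (Prod.ext ?_ ?_)
      · simp only [hσ, hs, hs']
      · simp only [hσ, hs', hι (s h), hι h, hs]
    · simp [mul_assoc]

lemma cycleType_of_involutive [Fintype H] [DecidableEq H] [Nonempty H] {ρ : Equiv.Perm H}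
    (h2 : ∀ h, ρ (ρ h) = h) (hne : ∀ h, ρ h ≠ h) :
    ρ.cycleType = Multiset.replicate (Fintype.card H / 2) 2 := by
  have hord : orderOf ρ = 2 := by
    refine orderOf_eq_prime ?_ ?_
    · ext h
      simp [pow_two, h2]
    · intro h
      obtain ⟨a⟩ := ‹Nonempty H›
      exact hne a (by rw [h]; rfl)
  obtain ⟨n, hn⟩ := Equiv.Perm.cycleType_prime_order (σ := ρ) (by rw [hord]; exact Nat.prime_two)
  have hsum := ρ.sum_cycleType
  have hsupp : ρ.support = Finset.univ := by
    ext h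
    simp [hne h]
  rw [hsupp, Finset.card_univ, hn, hord, Multiset.sum_replicate, smul_eq_mul] at hsum
  rw [hn, hord, ← hsum, Nat.mul_div_cancel _ two_pos]

/-- Every graph with the right degrees arises from a simple pairing. -/
lemma exists_simplePairing [Fintype H] [Nonempty H] [Finite V]
    (hι : Function.Involutive ι) (hne : ∀ h, ι h ≠ h) (vtx : H → V) (G : SimpleGraph V)
    (hG : ∀ v, (G.neighborSet v).ncard = {h | vtx h = v}.ncard) :
    ∃ π : Equiv.Perm H, IsSimplePairing ι (vtx ∘ π) ∧ pairingGraph ι hι (vtx ∘ π) = G := by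
  classical
  have hfib : ∀ v, Nonempty ({a : G.Dart // a.fst = v} ≃ {h : H // vtx h = v}) := by
    intro v
    refine ⟨Equiv.trans ?_ (Finite.card_eq.1 (hG v)).some⟩
    exact {
      toFun := fun a => ⟨a.1.snd, by simpa [a.2] using a.1.adj⟩
      invFun := fun u => ⟨⟨(v, u.1), u.2⟩, rfl⟩
      left_inv := by
        rintro ⟨⟨⟨a, b⟩, hab⟩, rfl⟩
        rfl
      right_inv := fun _ => rfl }
  let c : G.Dart ≃ H := Equiv.ofFiberEquiv (f := fun a : G.Dart => a.fst) fun v => (hfib v).some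
  have hc : ∀ a, vtx (c a) = a.fst := fun a =>
    Equiv.ofFiberEquiv_map (f := fun a : G.Dart => a.fst) _ a
  let ρ : Equiv.Perm H := c.symm.trans
    ((Function.Involutive.toPerm _ SimpleGraph.Dart.symm_involutive).trans c)
  have hρ : ∀ h, ρ h = c (c.symm h).symm := fun _ => rfl
  have hconj : IsConj (hι.toPerm ι) ρ := by
    rw [Equiv.Perm.isConj_iff_cycleType_eq, cycleType_of_involutive (ρ := hι.toPerm ι) hι hne,
      cycleType_of_involutive]
    · intro h
      simp [hρ]
    · intro h heq
      rw [hρ, ← c.eq_symm_apply] at heq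
      exact SimpleGraph.Dart.symm_ne _ heq
  obtain ⟨π, hπ⟩ := isConj_iff.1 hconj
  have hπι : ∀ h, π (ι h) = ρ (π h) := by
    intro h
    rw [← hπ]
    simp
  have h1 : ∀ h, (vtx ∘ π) h = (c.symm (π h)).fst := fun h => by
    rw [← hc, c.apply_symm_apply, Function.comp_apply]
  have h2 : ∀ h, (vtx ∘ π) (ι h) = (c.symm (π h)).snd := fun h => by
    rw [Function.comp_apply, hπι, hρ, hc]
    rfl
  have hs : IsSimplePairing ι (vtx ∘ π) := by
    refine ⟨fun h => ?_, fun a b hab => ?_⟩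
    · rw [h1, h2]
      exact (c.symm (π h)).adj.ne
    · refine π.injective (c.symm.injective (SimpleGraph.Dart.ext _ _ (Prod.ext ?_ ?_)))
      · exact (h1 a).symm.trans ((congrArg Prod.fst hab).trans (h1 b))
      · exact (h2 a).symm.trans ((congrArg Prod.snd hab).trans (h2 b))
  refine ⟨π, hs, ?_⟩
  ext u v
  rw [pairingGraph_adj_iff hs]
  constructor
  · rintro ⟨h, rfl, rfl⟩
    rw [h1, h2]
    exact (c.symm (π h)).adj
  · intro huv
    refine ⟨π.symm (c ⟨(u, v), huv⟩), ?_, ?_⟩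
    · rw [h1]
      simp
    · rw [h2]
      simp

/-- The number of simple pairings that give rise to a graph with a certain property. -/
lemma card_simplePairing_filter [Fintype H] [Nonempty H] [Finite V]
    (hι : Function.Involutive ι) (hne : ∀ h, ι h ≠ h) (vtx : H → V) (P : SimpleGraph V → Prop)
    (hP : ∀ G, P G → ∀ v, (G.neighborSet v).ncard = {h | vtx h = v}.ncard) :
    Nat.card {π : Equiv.Perm H // IsSimplePairing ι (vtx ∘ π) ∧
      P (pairingGraph ι hι (vtx ∘ π))} = Nat.card {G // P G} *
    Nat.card ({τ : Equiv.Perm H // vtx ∘ τ = vtx} ×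
      {σ : Equiv.Perm H // ∀ h, σ (ι h) = ι (σ h)}) := by
  let e : {π : Equiv.Perm H // IsSimplePairing ι (vtx ∘ π) ∧
      P (pairingGraph ι hι (vtx ∘ π))} ≃ Σ G : {G // P G}, {π : Equiv.Perm H //
        IsSimplePairing ι (vtx ∘ π) ∧ pairingGraph ι hι (vtx ∘ π) = G.1} :=
    { toFun := fun π => ⟨⟨_, π.2.2⟩, ⟨π.1, π.2.1, rfl⟩⟩
      invFun := fun p => ⟨p.2.1, p.2.2.1, p.2.2.2.symm ▸ p.1.2⟩
      left_inv := fun _ => rfl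
      right_inv := by
        rintro ⟨⟨G, hG⟩, π, hπ, heq⟩
        change _ = G at heq
        subst heq
        rfl }
  have := Fintype.ofFinite {G // P G}
  rw [Nat.card_congr e, Nat.card_sigma, Nat.card_eq_fintype_card, ← Finset.card_univ,
    ← smul_eq_mul, ← Finset.sum_const]
  refine Finset.sum_congr rfl fun G _ => ?_
  obtain ⟨π₀, h₀, hG⟩ := exists_simplePairing hι hne vtx G.1 (hP _ G.2)
  rw [← hG]
  exact card_simplePairing_eq vtx π₀ h₀

end PairingGraph

section Girth

variable {M : ℕ} {V : Type*}

lemma reachWithin_of_walk {G : SimpleGraph V} {E : Multiset (Sym2 V)} {u v : V} (p : G.Walk u v)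
    (h : ∀ e ∈ p.edges, e ∈ E) : ReachWithin E p.length u v := by
  induction p with
  | nil => exact ReachWithin.refl 0 _
  | cons hadj p ih =>
    simp only [SimpleGraph.Walk.edges_cons, List.mem_cons, forall_eq_or_imp] at h
    exact ReachWithin.step h.1 (ih h.2)

lemma mem_pairEdges (x : Fin (2 * M) → V) (h : Fin (2 * M)) :
    s(x h, x (partner h)) ∈ pairEdges x (pairSet (2 * M) M) := by
  rw [pairEdges, Multiset.mem_map]
  by_cases hpar : h.val % 2 = 0
  · refine ⟨(h, partner h), ?_, rfl⟩
    simp only [Finset.mem_val, pairSet, Finset.mem_filter, Finset.mem_univ, true_and, partner_val]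
    split_ifs
    omega
  · refine ⟨(partner h, h), ?_, Sym2.eq_swap⟩
    simp only [Finset.mem_val, pairSet, Finset.mem_filter, Finset.mem_univ, true_and, partner_val]
    split_ifs
    omega

variable [DecidableEq V]

lemma mem_erase_pairEdges (x : Fin (2 * M) → V) {h h' : Fin (2 * M)} (hne : h' ≠ h)
    (hne' : h' ≠ partner h) : s(x h', x (partner h')) ∈
      (pairEdges x (pairSet (2 * M) M)).erase s(x h, x (partner h)) := by
  have hfind : ∀ h : Fin (2 * M), ∃ e ∈ pairSet (2 * M) M,
      s(x e.1, x e.2) = s(x h, x (partner h)) ∧ (e.1 = h ∨ e.1 = partner h) := by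
    intro h
    by_cases hpar : h.val % 2 = 0
    · refine ⟨(h, partner h), ?_, rfl, Or.inl rfl⟩
      simp only [pairSet, Finset.mem_filter, Finset.mem_univ, true_and, partner_val]
      split_ifs
      omega
    · refine ⟨(partner h, h), ?_, Sym2.eq_swap, Or.inr rfl⟩
      simp only [pairSet, Finset.mem_filter, Finset.mem_univ, true_and, partner_val]
      split_ifs
      omega
  obtain ⟨e, he, hes, hcase⟩ := hfind h
  obtain ⟨e', he', hes', hcase'⟩ := hfind h'
  have hee : e' ≠ e := by
    rintro rfl
    rcases hcase with h1 | h1 <;> rcases hcase' with h2 | h2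
    · exact hne (h2.symm.trans h1)
    · exact hne' (by rw [← h1, h2, partner_partner])
    · exact hne' (h2.symm.trans h1)
    · exact hne (by rw [← partner_partner h', ← h2, h1, partner_partner])
  rw [← Finset.insert_erase he, pairEdges_insert _ (by simp), hes, Multiset.erase_cons_head,
    ← hes']
  exact Multiset.mem_map_of_mem _ (Finset.mem_erase.2 ⟨hee, he'⟩)

lemma isSimplePairing_of_noShortCycle {g : ℕ} (hg : 1 ≤ g) {x : Fin (2 * M) → V}
    (hx : NoShortCycle g (pairEdges x (pairSet (2 * M) M))) : IsSimplePairing partner x := by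
  have hne : ∀ h, x h ≠ x (partner h) := by
    intro h heq
    refine hx _ _ (mem_pairEdges x h) ?_
    rw [← heq]
    exact ReachWithin.refl _ _
  refine ⟨hne, fun a b hab => ?_⟩
  by_contra hab'
  simp only [Prod.mk.injEq] at hab
  refine hx _ _ (mem_pairEdges x a) (ReachWithin.mono (k := 1) ?_ (fun _ h => h) hg)
  have hmem := mem_erase_pairEdges x (h := a) (h' := b) (Ne.symm hab') ?_
  · rw [← hab.1, ← hab.2] at hmem
    exact ReachWithin.step hmem (ReachWithin.refl 0 _)
  · rintro rfl
    exact hne a hab.1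

lemma le_egirth_of_noShortCycle {g : ℕ} (hg : 1 ≤ g) {x : Fin (2 * M) → V}
    (hx : NoShortCycle g (pairEdges x (pairSet (2 * M) M))) :
    (g + 2 : ℕ) ≤ (pairingGraph partner partner_involutive x).egirth := by
  have hs := isSimplePairing_of_noShortCycle hg hx
  have hmem : ∀ u v, (pairingGraph partner partner_involutive x).Adj u v →
      s(u, v) ∈ pairEdges x (pairSet (2 * M) M) := by
    intro u v huv
    obtain ⟨h, rfl, rfl⟩ := (pairingGraph_adj_iff hs).1 huv
    exact mem_pairEdges x h
  rw [SimpleGraph.le_egirth]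
  intro a w hw
  cases w with
  | nil => exact absurd hw (by simp)
  | cons hadj p =>
    rw [SimpleGraph.Walk.cons_isCycle_iff] at hw
    by_contra hlen
    rw [not_le, SimpleGraph.Walk.length_cons, Nat.cast_lt] at hlen
    refine hx _ _ (hmem _ _ hadj) (((reachWithin_of_walk p ?_).symm).mono
      (fun _ h => h) (by omega))
    intro e he
    refine (Multiset.mem_erase_of_ne ?_).2 ?_
    · rintro rfl
      exact hw.2 he
    induction e with
    | h u v => exact hmem u v (p.adj_of_mem_edges he)

end Girth

section CubicGraphs

/-- The vertex `⌊h / 3⌋` incident to the half-edge `h`. -/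
def cubicVertex (k : ℕ) (h : Fin (2 * (3 * k))) : Fin (k + k) := ⟨h.val / 3, by omega⟩

lemma card_cubicVertex_fiber {k : ℕ} (v : Fin (k + k)) :
    (Finset.univ.filter fun h => cubicVertex k h = v).card = 3 := by
  have h : (Finset.univ.filter fun h => cubicVertex k h = v) =
      {⟨3 * v.val, by omega⟩, ⟨3 * v.val + 1, by omega⟩, ⟨3 * v.val + 2, by omega⟩} := by
    ext h
    simp only [Finset.mem_filter, Finset.mem_univ, true_and, Finset.mem_insert,
      Finset.mem_singleton, Fin.ext_iff, cubicVertex]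
    omega
  rw [h, Finset.card_eq_three]
  exact ⟨_, _, _, by simp, by simp, by simp, rfl⟩

lemma isCubic_iff {k : ℕ} {G : SimpleGraph (Fin (k + k))} :
    IsCubic G ↔ ∀ v, (G.neighborSet v).ncard = {h | cubicVertex k h = v}.ncard := by
  have h : ∀ v, {h | cubicVertex k h = v}.ncard = 3 := fun v => by
    refine Eq.trans ?_ (card_cubicVertex_fiber v)
    rw [← Set.ncard_coe_finset]
    simp
  simp only [h, IsCubic]

lemma card_comp_perm_fiber {H V : Type*} [Fintype H] [DecidableEq V] (x : H → V)
    (π : Equiv.Perm H) (v : V) :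
    (Finset.univ.filter fun i => (x ∘ π) i = v).card =
      (Finset.univ.filter fun i => x i = v).card :=
  Finset.card_bij (fun i _ => π i) (by simp) (by simp)
    fun b hb => ⟨π.symm b, by simpa using hb, by simp⟩

lemma exists_isIndep_ncard_eq {V : Type*} [Finite V] (G : SimpleGraph V) :
    ∃ s : Set V, IsIndep G s ∧ s.ncard = indepNum G :=
  Nat.sSup_mem (s := {n | ∃ s : Set V, IsIndep G s ∧ s.ncard = n})
    ⟨0, ∅, Set.pairwise_empty _, Set.ncard_empty V⟩
    ⟨Nat.card V, by
      rintro _ ⟨s, -, rfl⟩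
      rw [← Set.ncard_univ]
      exact Set.ncard_le_ncard s.subset_univ⟩

lemma indepNum_le_groundSize {M : ℕ} {V : Type*} [Fintype V] [DecidableEq V]
    {x : Fin (2 * M) → V} (hx : IsSimplePairing partner x) (r : ℕ) :
    indepNum (pairingGraph partner partner_involutive x) ≤ groundSize x (pairSet (2 * M) r) ∅ := by
  classical
  obtain ⟨s, hs, hcard⟩ := exists_isIndep_ncard_eq (pairingGraph partner partner_involutive x)
  refine le_trans (le_of_eq ?_) (Finset.le_sup (Finset.mem_univ s.toFinset))
  have h : (pairSet (2 * M) r).filter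
      (fun e => x e.1 ∈ s.toFinset ∧ x e.2 ∈ s.toFinset) = ∅ := by
    refine Finset.filter_eq_empty_iff.2 fun e he hmem => ?_
    rw [Set.mem_toFinset, Set.mem_toFinset] at hmem
    have hadj : (pairingGraph partner partner_involutive x).Adj (x e.1) (x e.2) :=
      (pairingGraph_adj_iff hx).2 ⟨e.1, rfl, by rw [(partner_of_mem_pairSet he).1]⟩
    exact hs hmem.1 hmem.2 hadj.ne hadj
  rw [← hcard, Set.ncard_eq_toFinset_card', penalizedCard, h]
  simp

lemma pow_le_sqrt_gibbsSum {M : ℕ} {V : Type*} [Fintype V] [DecidableEq V] (p : ℝ) {Y c : ℝ}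
    (hY : 1 ≤ Y) (hc0 : 0 ≤ c) {a b k r : ℕ} (hb : b ≠ 0) (hc : c ^ b ≤ Y ^ a)
    {x : Fin (2 * M) → V} (hx : IsSimplePairing partner x)
    (hk : a * k ≤ b * indepNum (pairingGraph partner partner_involutive x)) :
    c ^ k ≤ √(gibbsSum p (Y ^ 2) x (pairSet (2 * M) r) ∅) := by
  have hF := indepNum_le_groundSize hx r
  have hY0 : 0 ≤ Y := by linarith
  rw [gibbsSum, Finset.powerset_empty, Finset.sum_singleton, Finset.card_empty, Nat.sub_self,
    pow_zero, pow_zero, one_mul, one_mul, ← pow_mul, mul_comm 2, pow_mul,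
    Real.sqrt_sq (by positivity)]
  refine (pow_le_pow_iff_left₀ (by positivity) (by positivity) hb).1 ?_
  calc (c ^ k) ^ b = (c ^ b) ^ k := pow_right_comm c k b
    _ ≤ (Y ^ a) ^ k := pow_le_pow_left₀ (by positivity) hc k
    _ = Y ^ (a * k) := (pow_mul _ _ _).symm
    _ ≤ Y ^ (groundSize x (pairSet (2 * M) r) ∅ * b) :=
      pow_le_pow_right₀ hY (hk.trans (by rw [mul_comm]; exact Nat.mul_le_mul_right _ hF))
    _ = _ := pow_mul _ _ _

/-- The number of simple pairings that give rise to any given cubic graph. -/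
noncomputable def pairingMultiplicity (k : ℕ) : ℕ :=
  Nat.card ({τ : Equiv.Perm (Fin (2 * (3 * k))) // cubicVertex k ∘ τ = cubicVertex k} ×
    {σ : Equiv.Perm (Fin (2 * (3 * k))) // ∀ h, σ (partner h) = partner (σ h)})

lemma pairingMultiplicity_pos (k : ℕ) : 0 < pairingMultiplicity k := by
  have : Nonempty ({τ : Equiv.Perm (Fin (2 * (3 * k))) // cubicVertex k ∘ τ = cubicVertex k} ×
      {σ : Equiv.Perm (Fin (2 * (3 * k))) // ∀ h, σ (partner h) = partner (σ h)}) :=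
    ⟨⟨1, rfl⟩, ⟨1, fun _ => rfl⟩⟩
  exact Nat.card_pos

lemma card_cubic_mul_pairingMultiplicity {k : ℕ} (hk : 0 < k)
    (P : SimpleGraph (Fin (k + k)) → Prop) (hP : ∀ G, P G → IsCubic G) :
    Nat.card {π : Equiv.Perm (Fin (2 * (3 * k))) // IsSimplePairing partner (cubicVertex k ∘ π) ∧
      P (pairingGraph partner partner_involutive (cubicVertex k ∘ π))} =
    Nat.card {G // P G} * pairingMultiplicity k := by
  have : Nonempty (Fin (2 * (3 * k))) := ⟨⟨0, by omega⟩⟩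
  exact card_simplePairing_filter partner_involutive partner_ne _ P
    fun G hG => isCubic_iff.1 (hP G hG)

lemma factorial_mul_pow_le_card_cubic_girth {k g : ℕ} (hk : 0 < k) (hg : 1 ≤ g) {η : ℝ}
    (hη : η ≤ 1) (hM : (3 * 3 * (3 + 1) ^ g : ℕ) ≤ η * (2 * (3 * k : ℕ))) :
    (2 * (3 * k)).factorial * (1 - η) ^ (3 * k) ≤
      (Nat.card {G : SimpleGraph (Fin (k + k)) // IsCubic G ∧ (g + 2 : ℕ) ≤ G.egirth} : ℝ) *
        pairingMultiplicity k := by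
  refine (factorial_mul_pow_le_card_goodPerms (cubicVertex k)
    (fun v => (card_cubicVertex_fiber v).le) hη hM).trans ?_
  rw [← Nat.cast_mul, ← card_cubic_mul_pairingMultiplicity hk _ fun _ h => h.1, Nat.cast_le,
    ← Fintype.card_coe, ← Nat.card_eq_fintype_card]
  refine Nat.card_le_card_of_injective (Subtype.map id fun π hπ => ?_)
    (Subtype.map_injective _ Function.injective_id)
  replace hπ := mem_goodPerms.1 hπ
  have hs := isSimplePairing_of_noShortCycle hg hπ
  refine ⟨hs, fun v => ?_, le_egirth_of_noShortCycle hg hπ⟩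
  exact (ncard_neighborSet_pairingGraph hs v).trans
    ((card_comp_perm_fiber _ π v).trans (card_cubicVertex_fiber v))

lemma card_cubic_indepNum_mul_le {k s : ℕ} {p Y β c : ℝ} (hp0 : 0 ≤ p) (hp1 : p < 1)
    (hY : 1 ≤ Y) (hβ0 : 0 < β) (hβ1 : β ≤ 1) (hβ : β ^ 2 ≤ 1 - (1 - 1 / Y ^ 2) * p ^ 2)
    (hc0 : 0 ≤ c) {a b : ℕ} (hb : b ≠ 0) (hc : c ^ b ≤ Y ^ a) (hs : 1 ≤ s) (hk : s < 3 * k)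
    (P : SimpleGraph (Fin (k + k)) → Prop) (hP : ∀ G, P G → IsCubic G ∧ a * k ≤ b * indepNum G) :
    (Nat.card {G // P G} : ℝ) * pairingMultiplicity k *
        ((1 - p) ^ s * (c * ((1 - 1 / (2 * s : ℕ)) * β) ^ 3) ^ k) ≤
      24 * k ^ 2 * (2 * (3 * k)).factorial * (1 + (Y ^ 2 - 1) * (1 - p) ^ 3) ^ k := by
  classical
  have hκ0 : (0 : ℝ) ≤ 1 - 1 / (2 * s : ℕ) := by
    rw [sub_nonneg, div_le_one (by positivity)]
    exact_mod_cast (by omega : 1 ≤ 2 * s)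
  have hκ1 : 1 - 1 / ((2 * s : ℕ) : ℝ) ≤ 1 := sub_le_self _ (by positivity)
  have hq : 0 < 1 - p := by linarith
  have hw : 0 ≤ 1 + (Y ^ 2 - 1) * (1 - p) ^ 3 := by
    have : 0 ≤ Y ^ 2 - 1 := by nlinarith
    positivity
  set R := 3 * k - s
  have hmoment := sqrtMoment_le (X := Y ^ 2) hp0 hp1 (by nlinarith) hβ0 hβ (cubicVertex k)
    card_cubicVertex_fiber (n := k) (R := R) (s := s) (by simp [two_mul]) hs (by omega) (by omega)
  have hbad : (Nat.card {G // P G} : ℝ) * pairingMultiplicity k * c ^ k ≤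
      sqrtMoment p (Y ^ 2) (cubicVertex k) (pairSet (2 * (3 * k)) R) ∅ := by
    rw [← Nat.cast_mul, ← card_cubic_mul_pairingMultiplicity (by omega) P fun G h => (hP G h).1,
      Nat.card_eq_fintype_card, Fintype.card_subtype, ← nsmul_eq_mul, ← Finset.sum_const]
    refine (Finset.sum_le_sum fun π hπ => ?_).trans
      (Finset.sum_le_univ_sum_of_nonneg fun π => Real.sqrt_nonneg _)
    obtain ⟨h1, h2⟩ := (Finset.mem_filter.1 hπ).2
    exact pow_le_sqrt_gibbsSum p hY hc0 hb hc h1 (hP _ h2).2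
  set κ : ℝ := 1 - 1 / (2 * s : ℕ)
  calc (Nat.card {G // P G} : ℝ) * pairingMultiplicity k * ((1 - p) ^ s * (c * (κ * β) ^ 3) ^ k)
      = (1 - p) ^ s * (κ * β) ^ (3 * k) *
          (Nat.card {G // P G} * pairingMultiplicity k * c ^ k) := by
        rw [mul_pow, ← pow_mul]; ring
    _ ≤ (1 - p) ^ s * (κ * β) ^ R * sqrtMoment p (Y ^ 2) (cubicVertex k)
          (pairSet (2 * (3 * k)) R) ∅ := by
        refine mul_le_mul (mul_le_mul_of_nonneg_left ?_ (by positivity)) hbad (by positivity)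
          (by positivity)
        exact pow_le_pow_of_le_one (by positivity) (mul_le_one₀ hκ1 hβ0.le hβ1) (by omega)
    _ ≤ _ := hmoment
    _ ≤ _ := by
        have h1 : (R : ℝ) ≤ 3 * k := by exact_mod_cast (by omega : R ≤ 3 * k)
        have h2 : (1 : ℝ) ≤ k := by exact_mod_cast (by omega : 1 ≤ k)
        have h3 : (0 : ℝ) ≤ R := Nat.cast_nonneg _
        have h4 : 2 * (R : ℝ) * (R + 1) ≤ 24 * k ^ 2 := by nlinarith
        gcongr

/-- Comparison of the numbers of cubic graphs of large independence number and of large girth. -/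
lemma card_cubic_indepNum_le {k s g : ℕ} {p Y β c η : ℝ} (hp0 : 0 ≤ p) (hp1 : p < 1)
    (hY : 1 ≤ Y) (hβ0 : 0 < β) (hβ1 : β ≤ 1) (hβ : β ^ 2 ≤ 1 - (1 - 1 / Y ^ 2) * p ^ 2)
    (hc0 : 0 ≤ c) {a b : ℕ} (hb : b ≠ 0) (hc : c ^ b ≤ Y ^ a) (hs : 1 ≤ s) (hk : s < 3 * k)
    (hg : 1 ≤ g) (hη : η ≤ 1) (hM : (3 * 3 * (3 + 1) ^ g : ℕ) ≤ η * (2 * (3 * k : ℕ)))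
    (P : SimpleGraph (Fin (k + k)) → Prop) (hP : ∀ G, P G → IsCubic G ∧ a * k ≤ b * indepNum G) :
    (Nat.card {G // P G} : ℝ) *
        ((1 - p) ^ s * (c * ((1 - 1 / (2 * s : ℕ)) * β) ^ 3 * (1 - η) ^ 3) ^ k) ≤
      24 * k ^ 2 * (1 + (Y ^ 2 - 1) * (1 - p) ^ 3) ^ k *
        (Nat.card {G : SimpleGraph (Fin (k + k)) // IsCubic G ∧ (g + 2 : ℕ) ≤ G.egirth} : ℝ) := by
  have h1 := card_cubic_indepNum_mul_le hp0 hp1 hY hβ0 hβ1 hβ hc0 hb hc hs hk P hP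
  have h2 := factorial_mul_pow_le_card_cubic_girth (by omega) hg hη hM
  have hq : 0 ≤ 1 - η := by linarith
  have hw : 0 ≤ 1 + (Y ^ 2 - 1) * (1 - p) ^ 3 := by
    have : 0 ≤ Y ^ 2 - 1 := by nlinarith
    have : 0 ≤ 1 - p := by linarith
    positivity
  have hK : (0 : ℝ) < pairingMultiplicity k := by exact_mod_cast pairingMultiplicity_pos k
  refine le_of_mul_le_mul_right ?_ hK
  rw [pow_mul] at h2
  refine le_trans (le_of_eq ?_) ((mul_le_mul_of_nonneg_right h1
    (pow_nonneg (pow_nonneg hq 3) k)).trans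
    (le_trans (le_of_eq ?_) ((mul_le_mul_of_nonneg_left h2 (a := 24 * (k : ℝ) ^ 2 *
      (1 + (Y ^ 2 - 1) * (1 - p) ^ 3) ^ k) (by positivity)).trans (le_of_eq ?_))))
  · rw [mul_pow _ ((1 - η) ^ 3)]; ring
  · ring
  · ring

end CubicGraphs

/-- for every `ε > 0` there is `N > 0` such that for every even `n > N`, the
number of cubic simple graphs on `{1,…,n}` with girth at least 16 and independence number
greater than `0.454·n` is less than `ε` times the number of cubic simple graphs on `{1,…,n}`
with girth at least 16. -/
theorem almost_no_cubic_graph_large_independence_number (ε : ℝ) (hε : 0 < ε) :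
    ∃ N : ℕ, 0 < N ∧ ∀ n : ℕ, Even n → N < n →
      (Nat.card {G : SimpleGraph (Fin n) //
          IsCubic G ∧ 16 ≤ G.egirth ∧ 0.454 * (n : ℝ) < (indepNum G : ℝ)} : ℝ)
        < ε * (Nat.card {G : SimpleGraph (Fin n) // IsCubic G ∧ 16 ≤ G.egirth} : ℝ) := by
  obtain ⟨s, hs⟩ : ∃ s : ℕ, s = 5000 := ⟨_, rfl⟩
  obtain ⟨q, hq0, hq⟩ : ∃ q : ℝ, 0 < q ∧ q = (1 - 16 / 25) ^ s :=
    ⟨_, pow_pos (by norm_num) s, rfl⟩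
  obtain ⟨w, hw⟩ : ∃ w : ℝ, w = 1 + ((7 / 2) ^ 2 - 1) * (1 - 16 / 25) ^ 3 := ⟨_, rfl⟩
  obtain ⟨θ, hθ⟩ : ∃ θ : ℝ, θ = 623 / 200 * ((1 - 1 / (2 * s : ℕ)) * (7897 / 10000)) ^ 3 *
    (1 - 1 / 1000) ^ 3 := ⟨_, rfl⟩
  have hw0 : 0 < w := by rw [hw]; norm_num
  have hθ0 : 0 < θ := by rw [hθ, hs]; norm_num
  have hwθ : w < θ := by rw [hw, hθ, hs]; norm_num
  have hr1 : |w / θ| < 1 := by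
    rw [abs_of_pos (by positivity)]
    exact (div_lt_one hθ0).2 hwθ
  have hlim := (tendsto_pow_const_mul_const_pow_of_abs_lt_one 2 hr1).eventually_lt_const
    (show 0 < ε * q / 24 by positivity)
  obtain ⟨K, hK⟩ := Filter.eventually_atTop.1 hlim
  refine ⟨2 * K + 2 * 10 ^ 12, by omega, ?_⟩
  rintro _ ⟨k, rfl⟩ hk
  have hk12 : 10 ^ 12 < k := by omega
  have hη : ((3 * 3 * (3 + 1) ^ 14 : ℕ) : ℝ) ≤ 1 / 1000 * (2 * (3 * k : ℕ)) := by
    have : (10 ^ 12 : ℝ) < k := by exact_mod_cast hk12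
    push_cast
    linarith
  have hcongr (G : SimpleGraph (Fin (k + k))) :
      (IsCubic G ∧ ((14 + 2 : ℕ) : ℕ∞) ≤ G.egirth) = (IsCubic G ∧ 16 ≤ G.egirth) := by
    norm_num
  have hβ : (7897 / 10000 : ℝ) ^ 2 ≤ 1 - (1 - 1 / (7 / 2) ^ 2) * (16 / 25) ^ 2 := by norm_num
  have hmain := card_cubic_indepNum_le (p := 16 / 25) (Y := 7 / 2) (c := 623 / 200) (s := s)
    (by norm_num) (by norm_num) (by norm_num) (by norm_num) (by norm_num) hβ (by norm_num)
    (a := 227) (b := 250) (by norm_num) (by norm_num) (by omega) (by omega) (g := 14) (by norm_num)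
    (by norm_num) hη
    (fun G => IsCubic G ∧ 16 ≤ G.egirth ∧ 0.454 * ((k + k : ℕ) : ℝ) < (indepNum G : ℝ))
    fun G hG => ⟨hG.1, by
      have h := hG.2.2
      have : (227 * k : ℝ) ≤ 250 * indepNum G := by
        push_cast at h
        linarith
      exact_mod_cast this⟩
  have hgood := factorial_mul_pow_le_card_cubic_girth (k := k) (by omega) (g := 14) (by norm_num)
    (by norm_num) hη
  simp only [hcongr] at hmain hgood
  rw [← hq, ← hw, ← hθ] at hmain
  have hcard : (0 : ℝ) < Nat.card {G : SimpleGraph (Fin (k + k)) // IsCubic G ∧ 16 ≤ G.egirth} := by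
    refine pos_of_mul_pos_left (lt_of_lt_of_le ?_ hgood) (Nat.cast_nonneg _)
    exact mul_pos (by exact_mod_cast Nat.factorial_pos _) (pow_pos (by norm_num) _)
  have hdecay : 24 * (k : ℝ) ^ 2 * w ^ k < ε * (q * θ ^ k) := by
    have h := hK k (by omega)
    rw [div_pow, ← mul_div_assoc, div_lt_iff₀ (by positivity)] at h
    linarith
  refine lt_of_mul_lt_mul_right ?_ (show 0 ≤ q * θ ^ k by positivity)
  calc _ ≤ _ := hmain
    _ < _ := mul_lt_mul_of_pos_right hdecay hcard
    _ = _ := by ring
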